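/- arXiv:math/0512321 — 4 statements merged into one kernel-verified Lean document; each statement's English description precedes it below -/
import Mathlib

section
/- Let A be a commutative unital complex Banach algebra, let u ∈ A, and let (c_j)_{j≥1} be a submultiplicative sequence of positive real numbers. Then the following are equivalent: (i) there exist a commutative unital complex Banach algebra B and an isometric unital algebra homomorphism ρ : A → B such that ρ(u) is invertible in B and ‖(ρ(u))^{-j}‖ ≤ c_j for all j ≥ 1; (ii) for every sequence (a_j)_{j≥0} in A with finite support (a_j = 0 for all but finitely many j) one has ‖a_0‖ ≤ Σ_{j=1}^∞ c_j ‖a_j − a_{j−1} u‖. -/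
open Polynomial

universe u

namespace Polynomial

variable {A : Type*} [NormedCommRing A] {w : ℕ → ℝ}

/-- The weighted `ℓ¹` seminorm `∑ j, w j * ‖a j‖` of a polynomial `∑ j, a j X ^ j`, for a
submultiplicative weight `w`. -/
noncomputable def weightedSeminorm (w : ℕ → ℝ) (hw : ∀ i, 0 ≤ w i)
    (hmul : ∀ i j, w (i + j) ≤ w i * w j) : RingSeminorm A[X] :=
  have hadd (p q : A[X]) : ((p + q).sum fun j a ↦ w j * ‖a‖) ≤
      (p.sum fun j a ↦ w j * ‖a‖) + q.sum fun j a ↦ w j * ‖a‖ := by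
    classical
    rw [sum_eq_of_subset _ (by simp) support_add,
      p.sum_eq_of_subset _ (by simp) Finset.subset_union_left,
      q.sum_eq_of_subset _ (by simp) Finset.subset_union_right, ← Finset.sum_add_distrib]
    refine Finset.sum_le_sum fun i _ ↦ ?_
    rw [coeff_add, ← mul_add]
    exact mul_le_mul_of_nonneg_left (norm_add_le _ _) (hw i)
  { toFun := fun p ↦ p.sum fun j a ↦ w j * ‖a‖
    map_zero' := by simp
    add_le' := hadd
    neg' := fun p ↦ by simp [sum_def]
    mul_le' := fun p q ↦ by
      have key {ι : Type} (s : Finset ι) (f : ι → A[X]) :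
          ((∑ i ∈ s, f i).sum fun j a ↦ w j * ‖a‖) ≤ ∑ i ∈ s, (f i).sum fun j a ↦ w j * ‖a‖ :=
        Finset.le_sum_of_subadditive (fun p : A[X] ↦ p.sum fun j a ↦ w j * ‖a‖) (by simp) hadd s f
      conv_lhs => rw [mul_eq_sum_sum]
      rw [sum_def p, Finset.sum_mul]
      refine (key _ _).trans (Finset.sum_le_sum fun i _ ↦ ?_)
      rw [sum_def q, sum_def q, Finset.mul_sum]
      refine (key _ _).trans (Finset.sum_le_sum fun j _ ↦ ?_)
      rw [sum_monomial_index _ (fun j a ↦ w j * ‖a‖) (by simp)]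
      calc w (i + j) * ‖p.coeff i * q.coeff j‖
          ≤ (w i * w j) * (‖p.coeff i‖ * ‖q.coeff j‖) :=
            mul_le_mul (hmul i j) (norm_mul_le _ _) (norm_nonneg _) (mul_nonneg (hw i) (hw j))
        _ = _ := by ring }

variable {hw : ∀ i, 0 ≤ w i} {hmul : ∀ i j, w (i + j) ≤ w i * w j}

theorem weightedSeminorm_apply (p : A[X]) :
    weightedSeminorm w hw hmul p = p.sum fun j a ↦ w j * ‖a‖ := rfl

theorem weightedSeminorm_eq_sum_range {p : A[X]} {n : ℕ} (hn : p.natDegree < n) :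
    weightedSeminorm w hw hmul p = ∑ j ∈ Finset.range n, w j * ‖p.coeff j‖ :=
  p.sum_over_range' (f := fun j a ↦ w j * ‖a‖) (by simp) n hn

theorem weightedSeminorm_monomial (n : ℕ) (a : A) :
    weightedSeminorm w hw hmul (monomial n a) = w n * ‖a‖ :=
  sum_monomial_index a (fun j a ↦ w j * ‖a‖) (by simp)

theorem weightedSeminorm_smul_le {𝕜 : Type*} [NormedField 𝕜] [NormedAlgebra 𝕜 A] (r : 𝕜)
    (p : A[X]) : weightedSeminorm w hw hmul (r • p) ≤ ‖r‖ * weightedSeminorm w hw hmul p := by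
  rw [weightedSeminorm_apply, weightedSeminorm_apply,
    sum_eq_of_subset _ (by simp) (support_smul r p), sum_def, Finset.mul_sum]
  refine le_of_eq (Finset.sum_congr rfl fun i _ ↦ ?_)
  rw [coeff_smul, norm_smul]
  ring

/-- Modulo `1 - u X`, constants keep their norm in the weighted seminorm. -/
theorem norm_le_weightedSeminorm_C_sub (hw0 : w 0 = 1) {u : A}
    (h : ∀ a : ℕ → A, {j : ℕ | a j ≠ 0}.Finite →
      ‖a 0‖ ≤ ∑' j : ℕ, w (j + 1) * ‖a (j + 1) - a j * u‖) (a : A) (b : A[X]) :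
    ‖a‖ ≤ weightedSeminorm w hw hmul (C a - (1 - C u * X) * b) := by
  set p := C a - (1 - C u * X) * b with hp
  have hp0 : p.coeff 0 = a - b.coeff 0 := by simp [hp, mul_coeff_zero]
  have hps (j : ℕ) : p.coeff (j + 1) = -(b.coeff (j + 1) - b.coeff j * u) := by
    simp [hp, sub_mul, mul_assoc, coeff_X_mul, mul_comm u]
  have hb : ‖b.coeff 0‖ ≤ ∑' j : ℕ, w (j + 1) * ‖p.coeff (j + 1)‖ := by
    simp only [hps, norm_neg]
    refine h b.coeff (b.support.finite_toSet.subset fun j hj ↦ ?_)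
    simpa using hj
  rw [tsum_eq_sum (s := Finset.range (p.natDegree + 1))] at hb
  · rw [weightedSeminorm_eq_sum_range (n := p.natDegree + 1 + 1) (by omega),
      Finset.sum_range_succ', hw0, one_mul, hp0]
    have := norm_add_le (a - b.coeff 0) (b.coeff 0)
    rw [sub_add_cancel] at this
    linarith
  · intro j hj
    rw [coeff_eq_zero_of_natDegree_lt (by simp at hj; omega), norm_zero, mul_zero]

end Polynomial

/-- A seminorm on a commutative algebra yields, modulo an ideal and after completion, a Banach
algebra. -/
theorem RingSeminorm.exists_banachAlgebra {𝕜 : Type*} [NormedField 𝕜] {R : Type u} [CommRing R]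
    [Algebra 𝕜 R] (N : RingSeminorm R) (hN : ∀ (r : 𝕜) (x : R), N (r • x) ≤ ‖r‖ * N x)
    (I : Ideal R) :
    ∃ (B : Type u) (_ : NormedCommRing B) (_ : NormedAlgebra 𝕜 B) (_ : CompleteSpace B)
      (φ : R →ₐ[𝕜] B), (∀ x ∈ I, φ x = 0) ∧ (∀ x, ‖φ x‖ ≤ N x) ∧
        ∀ x, ∀ ε > 0, ∃ y, x - y ∈ I ∧ N y < ‖φ x‖ + ε := by
  let : SeminormedCommRing R :=
    { N.toSeminormedRing, (inferInstance : CommRing R) with }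
  let : NormedAlgebra 𝕜 R := { (inferInstance : Algebra 𝕜 R) with norm_smul_le := hN }
  let φ : R →ₐ[𝕜] UniformSpace.Completion (R ⧸ I) :=
    { UniformSpace.Completion.coeRingHom.comp (Ideal.Quotient.mk I) with
      commutes' := fun r ↦ rfl }
  have hφ (x : R) : ‖φ x‖ = ‖Ideal.Quotient.mk I x‖ := UniformSpace.Completion.norm_coe _
  refine ⟨UniformSpace.Completion (R ⧸ I), inferInstance, inferInstance, inferInstance, φ,
    fun x hx ↦ ?_, fun x ↦ ?_, fun x ε hε ↦ ?_⟩
  · rw [← norm_eq_zero, hφ, Ideal.Quotient.eq_zero_iff_mem.mpr hx, norm_zero]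
  · rw [hφ]
    exact Ideal.Quotient.norm_mk_le I x
  · obtain ⟨y, hy, hlt⟩ := Ideal.Quotient.norm_mk_lt (Ideal.Quotient.mk I x) hε
    refine ⟨y, Ideal.Quotient.eq.mp hy.symm, ?_⟩
    rw [hφ]
    exact hlt

/-- The norm inequality forced by an inverse `v` of `u` with powers bounded by `c`. -/
theorem norm_le_tsum_of_mul_eq_one {B : Type*} [NormedCommRing B] {u v : B} (huv : u * v = 1)
    {c : ℕ → ℝ} (hc : ∀ j, 1 ≤ j → ‖v ^ j‖ ≤ c j) {a : ℕ → B}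
    (ha : {j : ℕ | a j ≠ 0}.Finite) :
    ‖a 0‖ ≤ ∑' j : ℕ, c (j + 1) * ‖a (j + 1) - a j * u‖ := by
  obtain ⟨n, hn⟩ := ha.bddAbove
  have hzero (j : ℕ) (hj : n < j) : a j = 0 := by
    by_contra h
    exact absurd (hn h) (by omega)
  rw [tsum_eq_sum (s := Finset.range (n + 1))]
  · have hterm (j : ℕ) : (a (j + 1) - a j * u) * v ^ (j + 1) =
        a (j + 1) * v ^ (j + 1) - a j * v ^ j := by
      linear_combination (-a j * v ^ j) * huv
    have hsum : ∑ j ∈ Finset.range (n + 1), (a (j + 1) - a j * u) * v ^ (j + 1) = -a 0 := by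
      simp only [hterm]
      rw [Finset.sum_range_sub (fun j ↦ a j * v ^ j), hzero (n + 1) (by omega)]
      simp
    rw [← norm_neg, ← hsum]
    refine (norm_sum_le _ _).trans (Finset.sum_le_sum fun j _ ↦ ?_)
    rw [mul_comm (c _)]
    exact (norm_mul_le _ _).trans
      (mul_le_mul_of_nonneg_left (hc _ (by omega)) (norm_nonneg _))
  · intro j hj
    have hj : n < j := by simp at hj; omega
    simp [hzero j hj, hzero (j + 1) (by omega)]

/-- Theorem 2.1: existence of a commutative Banach-algebra extension in
which `u` becomes invertible with prescribed growth `‖u⁻ʲ‖ ≤ c j`, iff the stated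
norm inequality holds for all finitely supported sequences. -/
theorem arens_refinement_iff {A : Type u} [NormedCommRing A] [NormOneClass A]
    [NormedAlgebra ℂ A] [CompleteSpace A] (u : A) (c : ℕ → ℝ)
    (hc_pos : ∀ j, 1 ≤ j → 0 < c j)
    (hc_submul : ∀ i j, 1 ≤ i → 1 ≤ j → c (i + j) ≤ c i * c j) :
    (∃ (B : Type u) (_ : NormedCommRing B) (_ : NormOneClass B) (_ : NormedAlgebra ℂ B)
        (_ : CompleteSpace B) (ρ : A →ₐ[ℂ] B) (v : B),
          (∀ a : A, ‖ρ a‖ = ‖a‖) ∧ ρ u * v = 1 ∧ v * ρ u = 1 ∧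
          (∀ j : ℕ, 1 ≤ j → ‖v ^ j‖ ≤ c j)) ↔
    (∀ a : ℕ → A, {j : ℕ | a j ≠ 0}.Finite →
      ‖a 0‖ ≤ ∑' j : ℕ, c (j + 1) * ‖a (j + 1) - a j * u‖) := by
  constructor
  · rintro ⟨B, _, _, _, _, ρ, v, hρ, huv, -, hv⟩ a ha
    have := norm_le_tsum_of_mul_eq_one huv hv (a := fun j ↦ ρ (a j))
      (ha.subset fun j hj h ↦ hj (by simp [h]))
    simpa only [← map_mul, ← map_sub, hρ] using this
  · intro h
    let w : ℕ → ℝ := fun j ↦ if j = 0 then 1 else c j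
    have hw0 : w 0 = 1 := rfl
    have hw1 (j : ℕ) (hj : 1 ≤ j) : w j = c j := if_neg (by omega)
    have hw (j : ℕ) : 0 ≤ w j := by
      rcases j.eq_zero_or_pos with rfl | hj
      · simp [hw0]
      · exact (hw1 j hj).symm ▸ (hc_pos j hj).le
    have hmul (i j : ℕ) : w (i + j) ≤ w i * w j := by
      rcases i.eq_zero_or_pos with rfl | hi
      · simp [hw0]
      rcases j.eq_zero_or_pos with rfl | hj
      · simp [hw0]
      rw [hw1 i hi, hw1 j hj, hw1 _ (by omega)]
      exact hc_submul i j hi hj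
    obtain ⟨B, _, _, _, φ, hφ0, hφle, hφ⟩ :=
      (weightedSeminorm (A := A) w hw hmul).exists_banachAlgebra (𝕜 := ℂ)
        weightedSeminorm_smul_le (Ideal.span {1 - C u * X})
    have hiso (a : A) : ‖φ (C a)‖ = ‖a‖ := by
      refine le_antisymm ((hφle _).trans_eq ?_) (le_of_forall_pos_le_add fun ε hε ↦ ?_)
      · rw [← monomial_zero_left, weightedSeminorm_monomial, hw0, one_mul]
      · obtain ⟨y, hy, hlt⟩ := hφ (C a) ε hε
        obtain ⟨b, hb⟩ := Ideal.mem_span_singleton.mp hy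
        refine le_trans ?_ hlt.le
        rw [← sub_sub_cancel (C a) y, hb]
        exact norm_le_weightedSeminorm_C_sub hw0 h a b
    have huv : φ (C u) * φ X = 1 := by
      have := hφ0 _ (Ideal.mem_span_singleton_self _)
      rw [map_sub, map_one, map_mul, sub_eq_zero] at this
      exact this.symm
    refine ⟨B, inferInstance, ⟨?_⟩, inferInstance, inferInstance, φ.comp CAlgHom, φ X, hiso,
      huv, (mul_comm _ _).trans huv, fun j hj ↦ ?_⟩
    · rw [← map_one φ, ← C_1, hiso, norm_one]
    · rw [← map_pow, X_pow_eq_monomial, ← hw1 j hj]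
      refine (hφle _).trans_eq ?_
      rw [weightedSeminorm_monomial, norm_one, mul_one]
end

section
/- Let X be a complex Banach space and T a bounded linear operator on X such that m(T^n) > 0 for every n ≥ 1 and Σ_{n=1}^∞ (log max(‖T^n‖, m(T^n)^{-1})) / n² < ∞. Then there exist a complex Banach space Y, an isometric linear embedding π : X → Y, and an invertible bounded linear operator S on Y such that S ∘ π = π ∘ T, Σ_{n ∈ ℤ} (log ‖S^n‖) / (1+n²) < ∞ (where for negative n, S^n denotes the |n|-th iterate of S^{-1}), and the spectrum of S equals the approximate point spectrum of T, which equals the intersection of the spectrum of T with the unit circle {z ∈ ℂ : |z| = 1}. -/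
universe u

/-- The minimum modulus `m(T) = inf {‖T x‖ : ‖x‖ = 1}` of a bounded operator. -/
noncomputable def minMod {X : Type*} [NormedAddCommGroup X] [NormedSpace ℂ X]
    (T : X →L[ℂ] X) : ℝ :=
  sInf ((fun x : X => ‖T x‖) '' {x : X | ‖x‖ = 1})

/-- The approximate point spectrum
`σ_ap(T) = {λ ∈ ℂ : inf {‖(T - λ)x‖ : ‖x‖ = 1} = 0}`. -/
noncomputable def sigmaAp {X : Type*} [NormedAddCommGroup X] [NormedSpace ℂ X]
    (T : X →L[ℂ] X) : Set ℂ :=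
  {z : ℂ | sInf ((fun x : X => ‖T x - z • x‖) '' {x : X | ‖x‖ = 1}) = 0}

theorem nonpos_of_forall_nat_mul_le {x : ℝ} {c : ℕ → ℝ}
    (hc : Summable fun n : ℕ => c (n + 1) / ((n : ℝ) + 1) ^ 2)
    (h : ∀ n : ℕ, (n : ℝ) * x ≤ c n) : x ≤ 0 := by
  by_contra! hx
  have h1 : Summable fun n : ℕ => x * (((n + 1 : ℕ) : ℝ))⁻¹ := by
    refine Summable.of_nonneg_of_le (fun n => by positivity) (fun n => ?_) hc
    have h2 := h (n + 1)
    rw [le_div_iff₀ (by positivity)]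
    refine le_trans (le_of_eq ?_) h2
    push_cast
    field_simp
  rw [summable_mul_left_iff hx.ne'] at h1
  exact Real.not_summable_natCast_inv ((summable_nat_add_iff 1).1 h1)

theorem le_sum_two_pow_of_subadditive {α : ℕ → ℝ} (h0 : ∀ n, 0 ≤ α n) (hz : α 0 = 0)
    (hadd : ∀ m n, α (m + n) ≤ α m + α n) (k : ℕ) :
    ∀ j < 2 ^ k, α j ≤ ∑ i ∈ Finset.range k, α (2 ^ i) := by
  induction k with
  | zero => intro j hj; simp_all
  | succ k ih =>
    intro j hj
    rw [Finset.sum_range_succ]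
    rcases lt_or_ge j (2 ^ k) with h | h
    · linarith [ih j h, h0 (2 ^ k)]
    · obtain ⟨l, rfl⟩ := Nat.exists_eq_add_of_le h
      have := ih l (by rw [pow_succ] at hj; omega)
      linarith [hadd (2 ^ k) l]

theorem two_pow_mul_le_sum_of_subadditive {α : ℕ → ℝ} (h0 : ∀ n, 0 ≤ α n)
    (hadd : ∀ m n, α (m + n) ≤ α m + α n) (i : ℕ) :
    2 ^ i * α (2 ^ (i + 2)) ≤ ∑ n ∈ Finset.Ico (2 ^ i) (2 ^ (i + 2)), α n := by
  have hp : 2 ^ (i + 2) = 4 * 2 ^ i := by ring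
  have hpos : 0 < 2 ^ i := by positivity
  set N := 2 ^ i with hN
  have h1 : ∑ n ∈ Finset.Ico N (3 * N + 1), α (4 * N) ≤
      ∑ n ∈ Finset.Ico N (3 * N + 1), (α n + α (4 * N - n)) := by
    refine Finset.sum_le_sum fun n hn => ?_
    rw [Finset.mem_Ico] at hn
    have := hadd n (4 * N - n)
    rwa [Nat.add_sub_cancel' (by omega)] at this
  have h2 := Finset.sum_Ico_reflect α N (m := 3 * N + 1) (n := 4 * N) (by omega)
  rw [show 4 * N + 1 - (3 * N + 1) = N by omega,
    show 4 * N + 1 - N = 3 * N + 1 by omega] at h2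
  rw [Finset.sum_add_distrib, h2, Finset.sum_const, Nat.card_Ico, nsmul_eq_mul,
    show 3 * N + 1 - N = 2 * N + 1 by omega] at h1
  have h3 : ∑ n ∈ Finset.Ico N (3 * N + 1), α n ≤ ∑ n ∈ Finset.Ico N (4 * N), α n :=
    Finset.sum_le_sum_of_subset_of_nonneg
      (Finset.Ico_subset_Ico le_rfl (by omega)) fun _ _ _ => h0 _
  rw [hp]
  have h4 : (2 : ℝ) ^ i = (N : ℝ) := by simp [hN]
  rw [h4]
  push_cast at h1
  nlinarith [h0 (4 * N)]

theorem summable_two_pow_div_of_subadditive {α : ℕ → ℝ} (h0 : ∀ n, 0 ≤ α n)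
    (hadd : ∀ m n, α (m + n) ≤ α m + α n)
    (hs : Summable fun n : ℕ => α (n + 1) / ((n : ℝ) + 1) ^ 2) :
    Summable fun i : ℕ => α (2 ^ i) / 2 ^ i := by
  set f : ℕ → ℝ := fun n => α n / (n : ℝ) ^ 2 with hf
  have f0 : ∀ n, 0 ≤ f n := fun n => div_nonneg (h0 n) (by positivity)
  have fs : Summable f := by
    rw [← summable_nat_add_iff 1]
    simpa [hf] using hs
  set B : ℕ → ℝ := fun i => ∑ n ∈ Finset.Ico (2 ^ i) (2 ^ (i + 1)), f n with hB
  have Bs : Summable B := by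
    refine summable_of_sum_range_le (c := ∑' n, f n)
      (fun i => Finset.sum_nonneg fun n _ => f0 n) fun K => ?_
    have : ∑ i ∈ Finset.range K, B i = ∑ n ∈ Finset.Ico 1 (2 ^ K), f n := by
      induction K with
      | zero => simp
      | succ K ih =>
        rw [Finset.sum_range_succ, ih, hB]
        exact Finset.sum_Ico_consecutive f Nat.one_le_two_pow
          (Nat.pow_le_pow_right (by norm_num) (by omega))
    rw [this]
    exact fs.sum_le_tsum _ fun n _ => f0 n
  rw [← summable_nat_add_iff 2]
  refine Summable.of_nonneg_of_le (fun i => div_nonneg (h0 _) (by positivity)) (fun i => ?_)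
    ((Bs.add ((summable_nat_add_iff 1).2 Bs)).mul_left 4)
  have h1 : B i + B (i + 1) = ∑ n ∈ Finset.Ico (2 ^ i) (2 ^ (i + 2)), f n :=
    Finset.sum_Ico_consecutive f (Nat.pow_le_pow_right (by norm_num) (by omega))
      (Nat.pow_le_pow_right (by norm_num) (by omega))
  have h2 : ∑ n ∈ Finset.Ico (2 ^ i) (2 ^ (i + 2)), α n ≤ (2 ^ (i + 2)) ^ 2 * (B i + B (i + 1)) := by
    rw [h1, Finset.mul_sum]
    refine Finset.sum_le_sum fun n hn => ?_
    rw [Finset.mem_Ico] at hn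
    have hn0 : (0 : ℝ) < n := by
      exact_mod_cast lt_of_lt_of_le (by positivity : 0 < 2 ^ i) hn.1
    have hn1 : (n : ℝ) ≤ 2 ^ (i + 2) := by exact_mod_cast hn.2.le
    simp only [hf]
    rw [mul_div_assoc', le_div_iff₀ (by positivity), mul_comm (α n)]
    exact mul_le_mul_of_nonneg_right (by gcongr) (h0 n)
  have h3 := (two_pow_mul_le_sum_of_subadditive h0 hadd i).trans h2
  have hp : (2 : ℝ) ^ (i + 2) = 4 * 2 ^ i := by ring
  rw [hp] at h3 ⊢
  have hpos : (0 : ℝ) < 2 ^ i := by positivity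
  rw [div_le_iff₀ (by positivity)]
  have h4 : (2 : ℝ) ^ i * α (2 ^ (i + 2)) ≤ 2 ^ i * (4 * (B i + B (i + 1)) * (4 * 2 ^ i)) := by
    linarith
  exact le_of_mul_le_mul_left h4 hpos

theorem summable_partialSum_div_sq {s : ℕ → ℝ} (h0 : ∀ n, 0 ≤ s n)
    (hs : Summable fun n : ℕ => s n / ((n : ℝ) + 1)) :
    Summable fun n : ℕ => (∑ m ∈ Finset.range (n + 1), s m) / ((n : ℝ) + 1) ^ 2 := by
  set γ : ℕ → ℝ := fun n => ∑ m ∈ Finset.range n, s m with hγ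
  have g0 : ∀ n, 0 ≤ γ n := fun n => Finset.sum_nonneg fun m _ => h0 m
  have key : Summable fun n : ℕ => γ (n + 1) / (((n : ℝ) + 1) * (n + 2)) := by
    refine summable_of_sum_range_le (c := ∑' n : ℕ, s n / ((n : ℝ) + 1))
      (fun n => div_nonneg (g0 _) (by positivity)) fun N => ?_
    have h1 : ∑ n ∈ Finset.range N, γ (n + 1) / (((n : ℝ) + 1) * (n + 2)) + γ (N + 1) / (N + 1) =
        ∑ n ∈ Finset.range (N + 1), s n / ((n : ℝ) + 1) := by
      induction N with
      | zero => simp [hγ]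
      | succ N ih =>
        rw [Finset.sum_range_succ _ (N + 1), ← ih, Finset.sum_range_succ]
        have : γ (N + 1 + 1) = γ (N + 1) + s (N + 1) := Finset.sum_range_succ _ _
        rw [this]
        push_cast
        field_simp
        ring
    have h2 : ∑ n ∈ Finset.range (N + 1), s n / ((n : ℝ) + 1) ≤ ∑' n : ℕ, s n / ((n : ℝ) + 1) :=
      hs.sum_le_tsum _ fun n _ => div_nonneg (h0 n) (by positivity)
    have h3 : 0 ≤ γ (N + 1) / ((N : ℝ) + 1) := div_nonneg (g0 _) (by positivity)
    linarith
  refine Summable.of_nonneg_of_le (fun n => div_nonneg (g0 _) (by positivity)) (fun n => ?_)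
    (key.mul_left 2)
  rw [mul_div_assoc', div_le_div_iff₀ (by positivity) (by positivity)]
  have : (0 : ℝ) ≤ n := n.cast_nonneg
  have h4 : ((n : ℝ) + 1) * (n + 2) ≤ 2 * (n + 1) ^ 2 := by nlinarith
  calc γ (n + 1) * (((n : ℝ) + 1) * (n + 2)) ≤ γ (n + 1) * (2 * (n + 1) ^ 2) :=
        mul_le_mul_of_nonneg_left h4 (g0 _)
    _ = _ := by ring

theorem subadditive_partialSum_of_antitone {s : ℕ → ℝ} (hs : Antitone s) (m n : ℕ) :
    ∑ i ∈ Finset.range (m + n), s i ≤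
      ∑ i ∈ Finset.range m, s i + ∑ i ∈ Finset.range n, s i := by
  rw [Finset.sum_range_add]
  gcongr with i
  exact hs (Nat.le_add_left i m)

/-- A nonnegative subadditive sequence `α` with `∑ α n / n² < ∞` has dyadic sums controlled by
a monotone subadditive sequence with the same summability property. -/
theorem exists_subadditive_dominating_dyadic_sums {α : ℕ → ℝ} (h0 : ∀ n, 0 ≤ α n)
    (hadd : ∀ m n, α (m + n) ≤ α m + α n)
    (hs : Summable fun n : ℕ => α (n + 1) / ((n : ℝ) + 1) ^ 2) :
    ∃ γ : ℕ → ℝ, γ 0 = 0 ∧ Monotone γ ∧ (∀ m n, γ (m + n) ≤ γ m + γ n) ∧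
      (Summable fun n : ℕ => γ (n + 1) / ((n : ℝ) + 1) ^ 2) ∧
      ∀ k n : ℕ, 2 ^ k ≤ n → 2 * ∑ i ∈ Finset.range (k + 1), α (2 ^ i) ≤ γ n := by
  set r : ℕ → ℝ := fun i => α (2 ^ i) / 2 ^ i with hr
  have r0 : ∀ i, 0 ≤ r i := fun i => div_nonneg (h0 _) (by positivity)
  have ranti : Antitone r := by
    refine antitone_nat_of_succ_le fun i => ?_
    simp only [hr]
    rw [div_le_div_iff₀ (by positivity) (by positivity)]
    have := hadd (2 ^ i) (2 ^ i)
    rw [← two_mul, ← pow_succ'] at this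
    rw [pow_succ (2 : ℝ)]
    nlinarith [show (0 : ℝ) < 2 ^ i by positivity]
  set s : ℕ → ℝ := fun m => 4 * r (Nat.log 2 m) with hs'
  have s0 : ∀ m, 0 ≤ s m := fun m => mul_nonneg (by norm_num) (r0 _)
  have santi : Antitone s := fun m n hmn =>
    mul_le_mul_of_nonneg_left (ranti (Nat.log_mono_right hmn)) (by norm_num)
  have ssum : Summable fun n : ℕ => s n / ((n : ℝ) + 1) := by
    rw [← summable_condensed_iff_of_nonneg]
    · refine Summable.of_nonneg_of_le
        (fun k => mul_nonneg (by positivity) (div_nonneg (s0 _) (by positivity))) (fun k => ?_)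
        ((summable_two_pow_div_of_subadditive h0 hadd hs).mul_left 4)
      simp only [hs', Nat.log_pow (le_refl 2)]
      push_cast
      rw [mul_div_assoc', div_le_iff₀ (by positivity)]
      have := r0 k
      simp only [hr] at this ⊢
      nlinarith [show (0 : ℝ) < 2 ^ k by positivity]
    · exact fun n => div_nonneg (s0 _) (by positivity)
    · intro m n _ hmn
      have : (m : ℝ) ≤ n := by exact_mod_cast hmn
      exact div_le_div₀ (s0 _) (santi hmn) (by positivity) (by linarith)
  have hmono : Monotone fun n => ∑ m ∈ Finset.range n, s m := fun m n hmn =>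
    Finset.sum_le_sum_of_subset_of_nonneg (Finset.range_mono hmn) fun _ _ _ => s0 _
  refine ⟨fun n => ∑ m ∈ Finset.range n, s m, by simp, hmono,
    subadditive_partialSum_of_antitone santi, summable_partialSum_div_sq s0 ssum, ?_⟩
  intro k n hkn
  refine le_trans ?_ (hmono hkn)
  clear hkn
  induction k with
  | zero => simp [hs', hr]; linarith [h0 1]
  | succ k ih =>
    rw [Finset.sum_range_succ]
    simp only at ih ⊢
    rw [pow_succ 2 k, mul_two, Finset.sum_range_add s]
    have h1 : ∑ i ∈ Finset.range (2 ^ k), s (2 ^ k + i) = 2 ^ k * (4 * r k) := by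
      rw [Finset.sum_congr rfl (g := fun _ => 4 * r k), Finset.sum_const, Finset.card_range,
        nsmul_eq_mul]
      · push_cast; rfl
      · intro i hi
        rw [Finset.mem_range] at hi
        simp only [hs']
        rw [Nat.log_eq_of_pow_le_of_lt_pow (m := k) (by omega) (by rw [pow_succ]; omega)]
    have h2 : r (k + 1) ≤ r k := ranti (Nat.le_succ k)
    have h3 : α (2 ^ k + 2 ^ k) = 2 * 2 ^ k * r (k + 1) := by
      simp only [hr]
      rw [← mul_two, ← pow_succ]
      field_simp
      ring
    rw [h1, h3]
    have : (2 : ℝ) ^ k * r (k + 1) ≤ 2 ^ k * r k := mul_le_mul_of_nonneg_left h2 (by positivity)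
    linarith

section Functional

variable {X : Type*} [NormedAddCommGroup X] [NormedSpace ℂ X]

theorem exists_functional_comp_eq (A : X →L[ℂ] X) {c : ℝ} (hA : ∀ x, ‖x‖ ≤ c * ‖A x‖)
    (φ : StrongDual ℂ X) : ∃ ψ : StrongDual ℂ X, ψ.comp A = φ ∧ ‖ψ‖ ≤ c * ‖φ‖ := by
  rcases subsingleton_or_nontrivial X with hX | hX
  · exact ⟨0, by ext x; simp [Subsingleton.elim x 0], by
      rw [Subsingleton.elim φ 0]; simp⟩
  obtain ⟨x₀, hx₀⟩ := exists_ne (0 : X)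
  have hc : 0 ≤ c := by
    by_contra! hc
    have := hA x₀
    nlinarith [norm_pos_iff.2 hx₀, norm_nonneg (A x₀)]
  have hinj : Function.Injective (A : X →ₗ[ℂ] X) := by
    rw [injective_iff_map_eq_zero]
    intro x hx
    have := hA x
    rw [show A x = 0 from hx, norm_zero, mul_zero] at this
    exact norm_le_zero_iff.1 this
  let e := LinearEquiv.ofInjective (A : X →ₗ[ℂ] X) hinj
  have he : ∀ y, ‖e.symm y‖ ≤ c * ‖y‖ := fun y => by
    have h1 := hA (e.symm y)
    have h2 : A (e.symm y) = y := by
      have := congrArg Subtype.val (e.apply_symm_apply y)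
      exact this
    rwa [h2] at h1
  let f : StrongDual ℂ (LinearMap.range (A : X →ₗ[ℂ] X)) :=
    (φ.toLinearMap.comp e.symm.toLinearMap).mkContinuous (c * ‖φ‖) fun y => by
      calc ‖φ (e.symm y)‖ ≤ ‖φ‖ * ‖e.symm y‖ := φ.le_opNorm _
        _ ≤ ‖φ‖ * (c * ‖y‖) := by gcongr; exact he y
        _ = _ := by ring
  obtain ⟨ψ, hψ, hn⟩ := exists_extension_norm_eq _ f
  refine ⟨ψ, ?_, ?_⟩
  · ext x
    have h1 := hψ (e x)
    have h2 : f (e x) = φ x := by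
      change φ (e.symm (e x)) = φ x
      rw [e.symm_apply_apply]
    rw [h2] at h1
    exact h1
  · rw [hn]
    exact LinearMap.mkContinuous_norm_le _ (mul_nonneg hc (norm_nonneg _)) _

theorem norm_comp_le_exp {A : X →L[ℂ] X} {a b M : ℝ} (hA : ‖A‖ ≤ Real.exp a)
    {φ : StrongDual ℂ X} (hφ : ‖φ‖ ≤ Real.exp b * M) :
    ‖φ.comp A‖ ≤ Real.exp (b + a) * M := by
  calc ‖φ.comp A‖ ≤ ‖φ‖ * ‖A‖ := φ.opNorm_comp_le A
    _ ≤ (Real.exp b * M) * Real.exp a :=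
      mul_le_mul hφ hA (norm_nonneg _) ((norm_nonneg _).trans hφ)
    _ = _ := by rw [Real.exp_add]; ring

/-- Every functional extends to a two-sided orbit under the adjoint of `T`, of controlled
growth. -/
theorem exists_orbit (T : X →L[ℂ] X) {α γ : ℕ → ℝ} (h0 : ∀ n, 0 ≤ α n) (hz : α 0 = 0)
    (hadd : ∀ m n, α (m + n) ≤ α m + α n) (hup : ∀ n, ‖T ^ n‖ ≤ Real.exp (α n))
    (hlow : ∀ n x, ‖x‖ ≤ Real.exp (α n) * ‖(T ^ n) x‖) (hγ0 : γ 0 = 0)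
    (hγ : ∀ k n : ℕ, 2 ^ k ≤ n → 2 * ∑ i ∈ Finset.range (k + 1), α (2 ^ i) ≤ γ n)
    (φ : StrongDual ℂ X) :
    ∃ Φ : ℤ → StrongDual ℂ X, Φ 0 = φ ∧ (∀ n, Φ (n + 1) = (Φ n).comp T) ∧
      ∀ n, ‖Φ n‖ ≤ Real.exp (γ n.natAbs) * ‖φ‖ := by
  choose F hF hFn using fun (n : ℕ) (ψ : StrongDual ℂ X) =>
    exists_functional_comp_eq (T ^ n) (hlow n) ψ
  let g : ℕ → StrongDual ℂ X := fun k => Nat.rec φ (fun i ψ => F (2 ^ i) ψ) k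
  have g0 : g 0 = φ := rfl
  have gs : ∀ k, g (k + 1) = F (2 ^ k) (g k) := fun k => rfl
  have gn : ∀ k, ‖g k‖ ≤ Real.exp (∑ i ∈ Finset.range k, α (2 ^ i)) * ‖φ‖ := by
    intro k
    induction k with
    | zero => simp [g0]
    | succ k ih =>
      rw [gs, Finset.sum_range_succ, add_comm, Real.exp_add, mul_assoc]
      exact (hFn _ _).trans (by gcongr)
  have pos : ∀ k : ℕ, 1 ≤ 2 ^ k := fun k => Nat.one_le_two_pow
  let h : ℕ → ℤ → StrongDual ℂ X := fun k n => (g k).comp (T ^ (n + 2 ^ k - 1).toNat)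
  have hs : ∀ k n, 0 ≤ n + 2 ^ k - 1 → h (k + 1) n = h k n := by
    intro k n hn
    have h1 : (n + 2 ^ (k + 1) - 1).toNat = 2 ^ k + (n + 2 ^ k - 1).toNat := by
      zify
      rw [Int.toNat_of_nonneg hn, Int.toNat_of_nonneg (by rw [pow_succ]; have := pos k; zify at this; omega)]
      ring
    simp only [h]
    rw [h1, pow_add, gs]
    conv_rhs => rw [← hF (2 ^ k) (g k)]
    rfl
  have hle : ∀ k n, 0 ≤ n + 2 ^ k - 1 → ∀ l, k ≤ l → h l n = h k n := by
    intro k n hn l hkl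
    induction l, hkl using Nat.le_induction with
    | base => rfl
    | succ l hkl ih =>
      rw [hs, ih]
      have : (2 : ℤ) ^ k ≤ 2 ^ l := pow_le_pow_right₀ (by norm_num) hkl
      linarith
  have hnat : ∀ n : ℤ, 0 ≤ n + 2 ^ n.natAbs - 1 := fun n => by
    have h1 : n.natAbs < 2 ^ n.natAbs := Nat.lt_two_pow_self
    zify at h1
    have := neg_abs_le n
    omega
  have heq : ∀ k n, 0 ≤ n + 2 ^ k - 1 → h n.natAbs n = h k n := by
    intro k n hn
    rw [← hle k n hn _ (le_max_left k n.natAbs),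
      ← hle n.natAbs n (hnat n) _ (le_max_right k n.natAbs)]
  refine ⟨fun n => h n.natAbs n, ?_, ?_, ?_⟩
  · simp only [h]
    ext x
    simp [g0]
  · intro n
    have h2 : 0 ≤ n + 1 + 2 ^ n.natAbs - 1 := by linarith [hnat n]
    simp only
    rw [heq _ _ h2]
    simp only [h]
    rw [show (n + 1 + 2 ^ n.natAbs - 1).toNat = (n + 2 ^ n.natAbs - 1).toNat + 1 by
      have := hnat n; omega, pow_succ]
    rfl
  · intro n
    rcases eq_or_ne n 0 with rfl | hn0
    · simp only [h]
      rw [show (φ : StrongDual ℂ X) = g 0 from rfl]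
      simp [hγ0]
      exact le_of_eq (by congr 1)
    have hN : n.natAbs ≠ 0 := by simpa using hn0
    obtain ⟨k, hk⟩ : ∃ k, k = Nat.log 2 n.natAbs := ⟨_, rfl⟩
    have k1 : 2 ^ k ≤ n.natAbs := hk ▸ Nat.pow_log_le_self 2 hN
    have k2 : n.natAbs < 2 ^ (k + 1) := hk ▸ Nat.lt_pow_succ_log_self (by norm_num) _
    have hγk := hγ k _ k1
    have hS : 0 ≤ ∑ i ∈ Finset.range (k + 1), α (2 ^ i) := Finset.sum_nonneg fun i _ => h0 _
    have hlt := le_sum_two_pow_of_subadditive h0 hz hadd (k + 1)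
    obtain hn | hn := lt_or_gt_of_ne hn0
    · have k2' : -n < 2 ^ (k + 1) := by zify at k2; rwa [abs_of_neg hn] at k2
      have hpos : 0 ≤ n + 2 ^ (k + 1) - 1 := by omega
      simp only
      rw [heq (k + 1) n hpos]
      refine (norm_comp_le_exp (hup _) (gn (k + 1))).trans ?_
      gcongr
      have := hlt (n + 2 ^ (k + 1) - 1).toNat (by
        zify
        rw [Int.toNat_of_nonneg hpos]
        omega)
      linarith
    · simp only
      rw [heq 0 n (by simp; omega)]
      refine (norm_comp_le_exp (hup _) (gn 0)).trans ?_
      gcongr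
      have := hlt n.natAbs k2
      have hn' : (n + 2 ^ 0 - 1).toNat = n.natAbs := by
        simp only [pow_zero]
        omega
      rw [hn']
      simp only [Finset.range_zero, Finset.sum_empty]
      linarith

end Functional

section OrbitSpace

open BoundedContinuousFunction

variable {X : Type*} [NormedAddCommGroup X] [NormedSpace ℂ X]

/-- Bounded two-sided sequences of functionals on `X`, with the supremum norm. -/
def DualSeq (X : Type*) [NormedAddCommGroup X] [NormedSpace ℂ X] := ℤ →ᵇ StrongDual ℂ X

namespace DualSeq

noncomputable instance : NormedAddCommGroup (DualSeq X) :=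
  inferInstanceAs (NormedAddCommGroup (ℤ →ᵇ StrongDual ℂ X))

noncomputable instance : NormedSpace ℂ (DualSeq X) :=
  inferInstanceAs (NormedSpace ℂ (ℤ →ᵇ StrongDual ℂ X))

instance : CoeFun (DualSeq X) fun _ => ℤ → StrongDual ℂ X :=
  ⟨fun ψ => (ψ : BoundedContinuousFunction ℤ (StrongDual ℂ X)).toFun⟩

/-- The bounded sequence with given terms. -/
noncomputable def mk (f : ℤ → StrongDual ℂ X) (C : ℝ) (h : ∀ n, ‖f n‖ ≤ C) : DualSeq X :=
  ofNormedAddCommGroupDiscrete f C h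

@[simp] theorem mk_apply (f : ℤ → StrongDual ℂ X) (C : ℝ) (h : ∀ n, ‖f n‖ ≤ C) (n : ℤ) :
    mk f C h n = f n := rfl

@[simp] theorem zero_apply (n : ℤ) : (0 : DualSeq X) n = 0 := rfl

@[simp] theorem add_apply (ψ χ : DualSeq X) (n : ℤ) : (ψ + χ) n = ψ n + χ n := rfl

@[simp] theorem smul_apply (c : ℂ) (ψ : DualSeq X) (n : ℤ) : (c • ψ) n = c • ψ n := rfl

@[ext] theorem ext {ψ χ : DualSeq X} (h : ∀ n, ψ n = χ n) : ψ = χ :=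
  BoundedContinuousFunction.ext h

theorem norm_apply_le (ψ : DualSeq X) (n : ℤ) : ‖ψ n‖ ≤ ‖ψ‖ :=
  BoundedContinuousFunction.norm_coe_le_norm (ψ : ℤ →ᵇ StrongDual ℂ X) n

theorem norm_le_of_forall {ψ : DualSeq X} {C : ℝ} (hC : 0 ≤ C) (h : ∀ n, ‖ψ n‖ ≤ C) : ‖ψ‖ ≤ C :=
  (BoundedContinuousFunction.norm_le hC).2 h

end DualSeq

/-- Two-sided orbits `n ↦ exp (γ |n|) • ψ n` of the adjoint of `T`, normed by `sup ‖ψ n‖`. -/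
def orbitSubmodule (T : X →L[ℂ] X) (γ : ℕ → ℝ) : Submodule ℂ (DualSeq X) where
  carrier := {ψ | ∀ n : ℤ, (Real.exp (γ (n + 1).natAbs) : ℂ) • ψ (n + 1) =
    (Real.exp (γ n.natAbs) : ℂ) • (ψ n).comp T}
  add_mem' := fun {a b} ha hb n => by
    simp only [DualSeq.add_apply, smul_add, ContinuousLinearMap.add_comp]
    rw [ha n, hb n]
  zero_mem' := fun n => by
    rw [DualSeq.zero_apply, DualSeq.zero_apply, ContinuousLinearMap.zero_comp]
    exact (smul_zero (A := StrongDual ℂ X) (_ : ℂ)).trans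
      (smul_zero (A := StrongDual ℂ X) (_ : ℂ)).symm
  smul_mem' := fun c a ha n => by
    simp only [DualSeq.smul_apply, ContinuousLinearMap.smul_comp]
    rw [smul_comm, ha n, smul_comm]

/-- The normed space of two-sided orbits of the adjoint of `T`. -/
def OrbitSpace (T : X →L[ℂ] X) (γ : ℕ → ℝ) : Type _ := orbitSubmodule T γ

noncomputable instance (T : X →L[ℂ] X) (γ : ℕ → ℝ) : NormedAddCommGroup (OrbitSpace T γ) :=
  (orbitSubmodule T γ).normedAddCommGroup

noncomputable instance (T : X →L[ℂ] X) (γ : ℕ → ℝ) : NormedSpace ℂ (OrbitSpace T γ) :=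
  (orbitSubmodule T γ).normedSpace

variable {T : X →L[ℂ] X} {γ : ℕ → ℝ}

namespace OrbitSpace

@[ext] theorem ext {ψ χ : OrbitSpace T γ} (h : ∀ n, ψ.1 n = χ.1 n) : ψ = χ :=
  Subtype.ext (DualSeq.ext h)

@[simp] theorem add_apply (ψ χ : OrbitSpace T γ) (n : ℤ) : (ψ + χ).1 n = ψ.1 n + χ.1 n := rfl

@[simp] theorem smul_apply (c : ℂ) (ψ : OrbitSpace T γ) (n : ℤ) :
    (c • ψ).1 n = c • ψ.1 n := rfl

theorem norm_apply_le (ψ : OrbitSpace T γ) (n : ℤ) : ‖ψ.1 n‖ ≤ ‖ψ‖ :=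
  DualSeq.norm_apply_le ψ.1 n

theorem norm_le_of_forall {ψ : OrbitSpace T γ} {C : ℝ} (hC : 0 ≤ C) (h : ∀ n, ‖ψ.1 n‖ ≤ C) :
    ‖ψ‖ ≤ C :=
  DualSeq.norm_le_of_forall hC h

end OrbitSpace

theorem exp_natAbs_add_sub_le (hmono : Monotone γ) (hadd : ∀ m n, γ (m + n) ≤ γ m + γ n)
    (k n : ℤ) : Real.exp (γ (n + k).natAbs - γ n.natAbs) ≤ Real.exp (γ k.natAbs) := by
  have := hmono (Int.natAbs_add_le n k)
  have := hadd n.natAbs k.natAbs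
  gcongr
  linarith

theorem norm_weighted_shift_le (hmono : Monotone γ) (hadd : ∀ m n, γ (m + n) ≤ γ m + γ n)
    (k : ℤ) (ψ : DualSeq X) (n : ℤ) :
    ‖(Real.exp (γ (n + k).natAbs - γ n.natAbs) : ℂ) • ψ (n + k)‖ ≤
      Real.exp (γ k.natAbs) * ‖ψ‖ := by
  rw [norm_smul, Complex.norm_real, Real.norm_of_nonneg (Real.exp_pos _).le]
  exact mul_le_mul (exp_natAbs_add_sub_le hmono hadd k n) (ψ.norm_apply_le _)
    (norm_nonneg _) (Real.exp_pos _).le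

/-- The shift by `k` of two-sided orbits, as a linear map. -/
noncomputable def orbitShiftLinear (T : X →L[ℂ] X) (hmono : Monotone γ)
    (hadd : ∀ m n, γ (m + n) ≤ γ m + γ n) (k : ℤ) : OrbitSpace T γ →ₗ[ℂ] OrbitSpace T γ where
  toFun ψ := ⟨DualSeq.mk
    (fun n => (Real.exp (γ (n + k).natAbs - γ n.natAbs) : ℂ) • ψ.1 (n + k))
    (Real.exp (γ k.natAbs) * ‖ψ.1‖) (norm_weighted_shift_le hmono hadd k ψ.1), fun n => by
      have h := ψ.2 (n + k)
      simp only [DualSeq.mk_apply, ContinuousLinearMap.smul_comp, smul_smul,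
        ← Complex.ofReal_mul, ← Real.exp_add, add_sub_cancel]
      rw [show n + 1 + k = n + k + 1 by ring]
      exact h⟩
  map_add' ψ χ :=
    OrbitSpace.ext fun n => smul_add (_ : ℂ) (ψ.1 (n + k)) (χ.1 (n + k))
  map_smul' c ψ :=
    OrbitSpace.ext fun n => smul_comm (_ : ℂ) c (ψ.1 (n + k))

/-- The shift by `k` of two-sided orbits. -/
noncomputable def orbitShift (T : X →L[ℂ] X) (hmono : Monotone γ)
    (hadd : ∀ m n, γ (m + n) ≤ γ m + γ n) (k : ℤ) : OrbitSpace T γ →L[ℂ] OrbitSpace T γ :=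
  (orbitShiftLinear T hmono hadd k).mkContinuous (Real.exp (γ k.natAbs)) fun ψ =>
    OrbitSpace.norm_le_of_forall (mul_nonneg (Real.exp_pos _).le (norm_nonneg _))
      (norm_weighted_shift_le hmono hadd k ψ.1)

theorem orbitShift_apply (hmono : Monotone γ) (hadd : ∀ m n, γ (m + n) ≤ γ m + γ n) (k : ℤ)
    (ψ : OrbitSpace T γ) (n : ℤ) :
    (orbitShift T hmono hadd k ψ).1 n =
      (Real.exp (γ (n + k).natAbs - γ n.natAbs) : ℂ) • ψ.1 (n + k) :=
  rfl

theorem norm_orbitShift_le (hmono : Monotone γ) (hadd : ∀ m n, γ (m + n) ≤ γ m + γ n) (k : ℤ) :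
    ‖orbitShift T hmono hadd k‖ ≤ Real.exp (γ k.natAbs) :=
  LinearMap.mkContinuous_norm_le _ (Real.exp_pos _).le _

theorem orbitShift_add (hmono : Monotone γ) (hadd : ∀ m n, γ (m + n) ≤ γ m + γ n) (j k : ℤ) :
    orbitShift T hmono hadd (j + k) =
      (orbitShift T hmono hadd k).comp (orbitShift T hmono hadd j) := by
  ext ψ n x
  simp only [ContinuousLinearMap.comp_apply, orbitShift_apply, smul_smul, ← Complex.ofReal_mul,
    ← Real.exp_add]
  rw [show n + (j + k) = n + k + j by ring]
  congr 3
  ring_nf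

theorem orbitShift_zero (hmono : Monotone γ) (hadd : ∀ m n, γ (m + n) ≤ γ m + γ n) :
    orbitShift T hmono hadd 0 = ContinuousLinearMap.id ℂ _ := by
  ext ψ n x
  simp [orbitShift_apply]

/-- The transpose of an action of `ℤ` on `E`, as a representation on the dual of `E`. -/
noncomputable def dualAction {E : Type*} [NormedAddCommGroup E] [NormedSpace ℂ E]
    (R : ℤ → E →L[ℂ] E) (h0 : R 0 = ContinuousLinearMap.id ℂ E)
    (hadd : ∀ j k, R (j + k) = (R k).comp (R j)) :
    Multiplicative ℤ →* (StrongDual ℂ E →L[ℂ] StrongDual ℂ E) where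
  toFun k := ContinuousLinearMap.precomp ℂ (R k.toAdd)
  map_one' := by
    ext f ψ
    simp [h0]
  map_mul' j k := by
    ext f ψ
    simp [hadd]

set_option synthInstance.maxHeartbeats 200000 in
theorem exists_unit_dual {E : Type*} [NormedAddCommGroup E] [NormedSpace ℂ E]
    (R : ℤ → E →L[ℂ] E) (h0 : R 0 = ContinuousLinearMap.id ℂ E)
    (hadd : ∀ j k, R (j + k) = (R k).comp (R j)) :
    ∃ u : (StrongDual ℂ E →L[ℂ] StrongDual ℂ E)ˣ,
      (∀ f, (u : StrongDual ℂ E →L[ℂ] StrongDual ℂ E) f = f.comp (R 1)) ∧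
      ∀ n : ℤ, ‖((u ^ n : (StrongDual ℂ E →L[ℂ] StrongDual ℂ E)ˣ) :
        StrongDual ℂ E →L[ℂ] StrongDual ℂ E)‖ ≤ ‖R n‖ := by
  refine ⟨(dualAction R h0 hadd).toHomUnits (Multiplicative.ofAdd (1 : ℤ)), fun f => rfl,
    fun n => ?_⟩
  rw [← map_zpow, ← ofAdd_zsmul, smul_eq_mul, mul_one]
  refine ContinuousLinearMap.opNorm_le_bound _ (norm_nonneg _) fun f => ?_
  rw [mul_comm]
  exact f.opNorm_comp_le (R n)

/-- Evaluation of orbits at time `0` and at a vector. -/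
noncomputable def orbitEval (T : X →L[ℂ] X) (γ : ℕ → ℝ) :
    X →L[ℂ] StrongDual ℂ (OrbitSpace T γ) :=
  LinearMap.mkContinuous₂
    (LinearMap.mk₂ ℂ (fun (x : X) (ψ : OrbitSpace T γ) => ψ.1 0 x)
      (by intros; simp) (by intros; simp) (by intros; simp) (by intros; simp))
    1 fun x ψ => by
      rw [one_mul, mul_comm]
      exact (ContinuousLinearMap.le_opNorm _ _).trans
        (mul_le_mul_of_nonneg_right (ψ.norm_apply_le 0)
          (norm_nonneg _))

theorem orbitEval_apply (x : X) (ψ : OrbitSpace T γ) :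
    orbitEval T γ x ψ = ψ.1 0 x :=
  rfl

theorem norm_orbitEval (hγ0 : γ 0 = 0)
    (horb : ∀ φ : StrongDual ℂ X, ∃ Φ : ℤ → StrongDual ℂ X, Φ 0 = φ ∧
      (∀ n, Φ (n + 1) = (Φ n).comp T) ∧ ∀ n, ‖Φ n‖ ≤ Real.exp (γ n.natAbs) * ‖φ‖) (x : X) :
    ‖orbitEval T γ x‖ = ‖x‖ := by
  apply le_antisymm
  · refine ((orbitEval T γ).le_opNorm x).trans ?_
    exact mul_le_of_le_one_left (norm_nonneg _) (LinearMap.mkContinuous₂_norm_le _ zero_le_one _)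
  obtain ⟨φ, hφ, hφx⟩ := exists_dual_vector'' ℂ x
  obtain ⟨Φ, hΦ0, hΦ, hΦn⟩ := horb φ
  have hb : ∀ n : ℤ, ‖(Real.exp (-γ n.natAbs) : ℂ) • Φ n‖ ≤ 1 := fun n => by
    rw [norm_smul, Complex.norm_real, Real.norm_of_nonneg (Real.exp_pos _).le]
    calc Real.exp (-γ n.natAbs) * ‖Φ n‖
        ≤ Real.exp (-γ n.natAbs) * (Real.exp (γ n.natAbs) * ‖φ‖) := by gcongr; exact hΦn n
      _ = ‖φ‖ := by rw [← mul_assoc, ← Real.exp_add]; simp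
      _ ≤ 1 := hφ
  let ψ : OrbitSpace T γ := ⟨DualSeq.mk _ 1 hb, fun n => by
    simp only [DualSeq.mk_apply, ContinuousLinearMap.smul_comp, smul_smul,
      ← Complex.ofReal_mul, ← Real.exp_add, add_neg_cancel, hΦ]⟩
  have hψ : ‖ψ‖ ≤ 1 := OrbitSpace.norm_le_of_forall zero_le_one hb
  have hψx : orbitEval T γ x ψ = ‖x‖ := by
    rw [orbitEval_apply]
    simp [ψ, hγ0, hΦ0, hφx]
  calc ‖x‖ = ‖orbitEval T γ x ψ‖ := by simp [hψx]
    _ ≤ ‖orbitEval T γ x‖ * ‖ψ‖ := ContinuousLinearMap.le_opNorm _ _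
    _ ≤ ‖orbitEval T γ x‖ := mul_le_of_le_one_right (norm_nonneg _) hψ

theorem orbitEval_comp_orbitShift (hmono : Monotone γ) (hadd : ∀ m n, γ (m + n) ≤ γ m + γ n)
    (hγ0 : γ 0 = 0) (x : X) :
    (orbitEval T γ x).comp (orbitShift T hmono hadd 1) =
      orbitEval T γ (T x) := by
  ext ψ
  have h := DFunLike.congr_fun (ψ.2 0) x
  simp [hγ0] at h
  rw [ContinuousLinearMap.comp_apply, orbitEval_apply, orbitEval_apply, orbitShift_apply]
  simp [hγ0, h]

end OrbitSpace

theorem coe_zpow_unitsEquiv {Y : Type*} [NormedAddCommGroup Y] [NormedSpace ℂ Y]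
    (u : (Y →L[ℂ] Y)ˣ) (n : ℤ) :
    (((ContinuousLinearEquiv.unitsEquiv ℂ Y u) ^ n : Y ≃L[ℂ] Y) : Y →L[ℂ] Y) =
      ((u ^ n : (Y →L[ℂ] Y)ˣ) : Y →L[ℂ] Y) := by
  rw [← map_zpow]
  rfl

theorem exists_invertible_extension {X : Type u} [NormedAddCommGroup X] [NormedSpace ℂ X]
    (T : X →L[ℂ] X) {γ : ℕ → ℝ} (hγ0 : γ 0 = 0) (hmono : Monotone γ)
    (hadd : ∀ m n, γ (m + n) ≤ γ m + γ n)
    (horb : ∀ φ : StrongDual ℂ X, ∃ Φ : ℤ → StrongDual ℂ X, Φ 0 = φ ∧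
      (∀ n, Φ (n + 1) = (Φ n).comp T) ∧ ∀ n, ‖Φ n‖ ≤ Real.exp (γ n.natAbs) * ‖φ‖) :
    ∃ (Y : Type u) (_ : NormedAddCommGroup Y) (_ : NormedSpace ℂ Y) (_ : CompleteSpace Y)
      (π : X →L[ℂ] Y) (u : (Y →L[ℂ] Y)ˣ),
        (∀ x : X, ‖π x‖ = ‖x‖) ∧ (∀ x : X, (u : Y →L[ℂ] Y) (π x) = π (T x)) ∧
        ∀ n : ℤ, ‖((u ^ n : (Y →L[ℂ] Y)ˣ) : Y →L[ℂ] Y)‖ ≤ Real.exp (γ n.natAbs) := by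
  obtain ⟨u, hu, hun⟩ := exists_unit_dual (orbitShift T hmono hadd) (orbitShift_zero hmono hadd)
    (orbitShift_add hmono hadd)
  exact ⟨StrongDual ℂ (OrbitSpace T γ), inferInstance, inferInstance, inferInstance,
    orbitEval T γ, u, norm_orbitEval hγ0 horb,
    fun x => (hu _).trans (orbitEval_comp_orbitShift hmono hadd hγ0 x),
    fun n => (hun n).trans (norm_orbitShift_le hmono hadd n)⟩

section Spectra

variable {X Y : Type*} [NormedAddCommGroup X] [NormedSpace ℂ X]
  [NormedAddCommGroup Y] [NormedSpace ℂ Y]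

theorem minMod_mul_norm_le (A : X →L[ℂ] X) (x : X) : minMod A * ‖x‖ ≤ ‖A x‖ := by
  rcases eq_or_ne x 0 with rfl | hx
  · simp
  have hx' : 0 < ‖x‖ := norm_pos_iff.2 hx
  have h : minMod A ≤ ‖A ((‖x‖ : ℂ)⁻¹ • x)‖ :=
    csInf_le ⟨0, by rintro _ ⟨y, _, rfl⟩; exact norm_nonneg _⟩
      ⟨_, by simp [norm_smul, hx'.ne'], rfl⟩
  rw [map_smul, norm_smul, norm_inv, Complex.norm_real, norm_norm] at h
  rwa [← le_div_iff₀ hx', div_eq_inv_mul]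

theorem nonempty_unit_sphere [Nontrivial X] : {x : X | ‖x‖ = 1}.Nonempty := by
  obtain ⟨x, hx⟩ := exists_norm_eq X zero_le_one
  exact ⟨x, hx⟩

theorem le_minMod [Nontrivial X] {A : X →L[ℂ] X} {c : ℝ} (h : ∀ x, c * ‖x‖ ≤ ‖A x‖) :
    c ≤ minMod A := by
  refine le_csInf (nonempty_unit_sphere.image _) ?_
  rintro _ ⟨x, hx, rfl⟩
  simpa [show ‖x‖ = 1 from hx] using h x

theorem sigmaAp_eq_minMod (T : X →L[ℂ] X) :
    sigmaAp T = {z : ℂ | minMod (T - z • (1 : X →L[ℂ] X)) = 0} := by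
  rfl

theorem notMem_sigmaAp_of_bound [Nontrivial X] {T : X →L[ℂ] X} {z : ℂ} {c : ℝ} (hc : 0 < c)
    (h : ∀ x, c * ‖x‖ ≤ ‖T x - z • x‖) : z ∉ sigmaAp T := by
  rw [sigmaAp_eq_minMod]
  exact (hc.trans_le (le_minMod h)).ne'

theorem exists_bound_of_notMem_sigmaAp {T : X →L[ℂ] X} {z : ℂ} (h : z ∉ sigmaAp T) :
    ∃ c > 0, ∀ x, c * ‖x‖ ≤ ‖T x - z • x‖ := by
  rw [sigmaAp_eq_minMod] at h
  refine ⟨_, lt_of_le_of_ne (Real.sInf_nonneg ?_) (Ne.symm h),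
    minMod_mul_norm_le (T - z • (1 : X →L[ℂ] X))⟩
  rintro _ ⟨y, _, rfl⟩
  exact norm_nonneg _

theorem norm_le_norm_inv_mul (v : (Y →L[ℂ] Y)ˣ) (y : Y) :
    ‖y‖ ≤ ‖((v⁻¹ : (Y →L[ℂ] Y)ˣ) : Y →L[ℂ] Y)‖ * ‖(v : Y →L[ℂ] Y) y‖ := by
  calc ‖y‖ = ‖((v⁻¹ : (Y →L[ℂ] Y)ˣ) : Y →L[ℂ] Y) ((v : Y →L[ℂ] Y) y)‖ := by
        rw [← mul_apply_eq_comp, v.inv_mul, one_apply_eq_self]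
    _ ≤ _ := ContinuousLinearMap.le_opNorm _ _

theorem sigmaAp_subset_spectrum_of_extension [Nontrivial X] {T : X →L[ℂ] X} {A : Y →L[ℂ] Y}
    (π : X →L[ℂ] Y) (hπ : ∀ x, ‖π x‖ = ‖x‖) (hA : ∀ x, A (π x) = π (T x)) :
    sigmaAp T ⊆ spectrum ℂ A := by
  intro z hz
  by_contra hn
  obtain ⟨v, hv⟩ := spectrum.notMem_iff.1 hn
  have hb : ∀ x, ‖x‖ ≤ ‖((v⁻¹ : (Y →L[ℂ] Y)ˣ) : Y →L[ℂ] Y)‖ * ‖T x - z • x‖ := fun x => by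
    have h1 := norm_le_norm_inv_mul v (π x)
    have h2 : (v : Y →L[ℂ] Y) (π x) = -π (T x - z • x) := by
      rw [hv, Algebra.algebraMap_eq_smul_one]
      simp [hA]
    rwa [h2, norm_neg, hπ, hπ] at h1
  refine notMem_sigmaAp_of_bound (c := (‖((v⁻¹ : (Y →L[ℂ] Y)ˣ) : Y →L[ℂ] Y)‖ + 1)⁻¹)
    (by positivity) (fun x => ?_) hz
  rw [inv_mul_le_iff₀ (by positivity)]
  nlinarith [hb x, norm_nonneg (T x - z • x)]

theorem frontier_spectrum_subset_sigmaAp [Nontrivial X] [CompleteSpace X] (T : X →L[ℂ] X) :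
    frontier (spectrum ℂ T) ⊆ sigmaAp T := by
  intro z hz
  by_contra hn
  obtain ⟨c, hc, hb⟩ := exists_bound_of_notMem_sigmaAp hn
  have hzs : z ∈ spectrum ℂ T := (spectrum.isClosed T).frontier_subset hz
  rw [frontier_eq_closure_inter_closure] at hz
  obtain ⟨w, hw, hzw⟩ := Metric.mem_closure_iff.1 hz.2 (c / 2) (by positivity)
  obtain ⟨v, hv⟩ := spectrum.notMem_iff.1 hw
  rw [dist_eq_norm] at hzw
  have hlow : ∀ x, c / 2 * ‖x‖ ≤ ‖(v : X →L[ℂ] X) x‖ := fun x => by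
    have h1 : (v : X →L[ℂ] X) x = -((T x - z • x) + (z - w) • x) := by
      rw [hv, Algebra.algebraMap_eq_smul_one, sub_smul]
      simp
    have h2 := norm_sub_norm_le (T x - z • x) (-((z - w) • x))
    rw [sub_neg_eq_add, norm_neg, norm_smul] at h2
    rw [h1, norm_neg]
    nlinarith [hb x, norm_nonneg x]
  have hinv : ‖((v⁻¹ : (X →L[ℂ] X)ˣ) : X →L[ℂ] X)‖ ≤ (c / 2)⁻¹ := by
    refine ContinuousLinearMap.opNorm_le_bound _ (by positivity) fun x => ?_
    have h3 := hlow (((v⁻¹ : (X →L[ℂ] X)ˣ) : X →L[ℂ] X) x)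
    rw [← mul_apply_eq_comp, v.mul_inv, one_apply_eq_self] at h3
    rwa [le_inv_mul_iff₀ (by positivity)]
  have hnear : ‖(algebraMap ℂ (X →L[ℂ] X) z - T) - v‖ <
      ‖((v⁻¹ : (X →L[ℂ] X)ˣ) : X →L[ℂ] X)‖⁻¹ := by
    have h4 : (algebraMap ℂ (X →L[ℂ] X) z - T) - v = algebraMap ℂ (X →L[ℂ] X) (z - w) := by
      rw [hv, map_sub]
      abel
    rw [h4, norm_algebraMap']
    refine hzw.trans_le ?_
    rw [le_inv_comm₀ (by positivity) (Units.norm_pos _)]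
    exact hinv
  exact spectrum.mem_iff.1 hzs ⟨Units.ofNearby v _ hnear, rfl⟩

theorem norm_le_one_of_mem_spectrum [Nontrivial Y] [CompleteSpace Y] {A : Y →L[ℂ] Y}
    {c : ℕ → ℝ} (hc : Summable fun n : ℕ => c (n + 1) / ((n : ℝ) + 1) ^ 2)
    (hA : ∀ n, ‖A ^ n‖ ≤ Real.exp (c n)) {z : ℂ} (hz : z ∈ spectrum ℂ A) : ‖z‖ ≤ 1 := by
  rcases eq_or_ne z 0 with rfl | hz0
  · simp
  have hpos : 0 < ‖z‖ := norm_pos_iff.2 hz0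
  refine (Real.log_nonpos_iff hpos.le).1 (nonpos_of_forall_nat_mul_le hc fun n => ?_)
  rw [← Real.log_pow, Real.log_le_iff_le_exp (by positivity), ← norm_pow]
  exact (spectrum.norm_le_norm_of_mem (spectrum.pow_mem_pow A n hz)).trans (hA n)

theorem norm_eq_one_of_mem_spectrum_unit [Nontrivial Y] [CompleteSpace Y] {u : (Y →L[ℂ] Y)ˣ}
    {c : ℕ → ℝ} (hc : Summable fun n : ℕ => c (n + 1) / ((n : ℝ) + 1) ^ 2)
    (hu : ∀ n : ℤ, ‖((u ^ n : (Y →L[ℂ] Y)ˣ) : Y →L[ℂ] Y)‖ ≤ Real.exp (c n.natAbs)) {z : ℂ}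
    (hz : z ∈ spectrum ℂ (u : Y →L[ℂ] Y)) : ‖z‖ = 1 := by
  have hz0 : z ≠ 0 := spectrum.ne_zero_of_mem_of_unit hz
  refine le_antisymm (norm_le_one_of_mem_spectrum hc (fun n => by simpa using hu n) hz) ?_
  have hz' : z⁻¹ ∈ spectrum ℂ ((u⁻¹ : (Y →L[ℂ] Y)ˣ) : Y →L[ℂ] Y) :=
    spectrum.inv_mem_iff (r := Units.mk0 z hz0).1 hz
  have := norm_le_one_of_mem_spectrum hc
    (fun n => by simpa [zpow_neg, inv_pow] using hu (-n)) hz'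
  rw [norm_inv] at this
  exact (inv_le_one₀ (norm_pos_iff.2 hz0)).1 this

theorem summable_log_norm_zpow [Nontrivial Y] {u : (Y →L[ℂ] Y)ˣ}
    {c : ℕ → ℝ} (hc : Summable fun n : ℕ => c (n + 1) / ((n : ℝ) + 1) ^ 2)
    (hu : ∀ n : ℤ, ‖((u ^ n : (Y →L[ℂ] Y)ˣ) : Y →L[ℂ] Y)‖ ≤ Real.exp (c n.natAbs)) :
    Summable fun n : ℤ => Real.log ‖((u ^ n : (Y →L[ℂ] Y)ˣ) : Y →L[ℂ] Y)‖ / (1 + (n : ℝ) ^ 2) := by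
  have hup : ∀ n : ℤ, Real.log ‖((u ^ n : (Y →L[ℂ] Y)ˣ) : Y →L[ℂ] Y)‖ ≤ c n.natAbs := fun n =>
    (Real.log_le_iff_le_exp (Units.norm_pos _)).2 (hu n)
  have habs : ∀ n : ℤ, |Real.log ‖((u ^ n : (Y →L[ℂ] Y)ˣ) : Y →L[ℂ] Y)‖| ≤ c n.natAbs := by
    intro n
    have h1 : (1 : ℝ) ≤ ‖((u ^ n : (Y →L[ℂ] Y)ˣ) : Y →L[ℂ] Y)‖ *
        ‖((u ^ (-n) : (Y →L[ℂ] Y)ˣ) : Y →L[ℂ] Y)‖ := by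
      refine le_trans ?_ (norm_mul_le _ _)
      rw [← Units.val_mul, ← zpow_add, add_neg_cancel, zpow_zero, Units.val_one, norm_one]
    have h2 := Real.log_nonneg h1
    rw [Real.log_mul (Units.norm_pos _).ne' (Units.norm_pos _).ne'] at h2
    have h3 := hup (-n)
    rw [Int.natAbs_neg] at h3
    exact abs_le.2 ⟨by linarith, hup n⟩
  have hc0 : ∀ n, 0 ≤ c n := fun n => (abs_nonneg _).trans (habs n)
  have hs : Summable fun n : ℕ => c n / (1 + (n : ℝ) ^ 2) := by
    rw [← summable_nat_add_iff 1]
    refine Summable.of_nonneg_of_le (fun n => div_nonneg (hc0 _) (by positivity)) (fun n => ?_) hc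
    push_cast
    exact div_le_div_of_nonneg_left (hc0 _) (by positivity) (by linarith)
  refine Summable.of_norm_bounded (g := fun n : ℤ => c n.natAbs / (1 + (n : ℝ) ^ 2))
    (Summable.of_nat_of_neg (by simpa using hs) (by simpa using hs)) fun n => ?_
  rw [norm_div, Real.norm_eq_abs, Real.norm_of_nonneg (by positivity : 0 ≤ 1 + (n : ℝ) ^ 2)]
  gcongr
  exact habs n

theorem sigmaAp_eq_spectrum_inter_circle [Nontrivial X] [CompleteSpace X] {T : X →L[ℂ] X}
    (hT : ∀ z ∈ spectrum ℂ T, ‖z‖ ≤ 1) (hap : ∀ z ∈ sigmaAp T, ‖z‖ = 1) :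
    sigmaAp T = spectrum ℂ T ∩ {z : ℂ | ‖z‖ = 1} := by
  apply subset_antisymm
  · exact fun z hz => ⟨sigmaAp_subset_spectrum_of_extension (A := T)
      (ContinuousLinearMap.id ℂ X) (fun _ => rfl) (fun _ => rfl) hz, hap z hz⟩
  · rintro z ⟨hz, hz1⟩
    have hball : spectrum ℂ T ⊆ Metric.closedBall 0 1 := fun w hw => by
      simpa using hT w hw
    refine frontier_spectrum_subset_sigmaAp T ⟨subset_closure hz, fun hi => ?_⟩
    have := interior_mono hball hi
    rw [interior_closedBall _ one_ne_zero, mem_ball_zero_iff] at this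
    exact this.ne hz1

theorem circle_subset_sigmaAp [Nontrivial X] [CompleteSpace X] {T : X →L[ℂ] X}
    (hT : ¬IsUnit T) (hap : ∀ z ∈ sigmaAp T, ‖z‖ = 1)
    (hspec : sigmaAp T = spectrum ℂ T ∩ {z : ℂ | ‖z‖ = 1}) {z : ℂ} (hz : ‖z‖ = 1) :
    z ∈ sigmaAp T := by
  by_contra hn
  have hzn : z ∉ spectrum ℂ T := fun h => hn (hspec ▸ ⟨h, hz⟩)
  have h0 : (0 : ℂ) ∈ spectrum ℂ T := by
    rwa [spectrum.zero_mem_iff]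
  obtain ⟨w, hw, hwf⟩ : ∃ w ∈ segment ℝ 0 z, w ∈ frontier (spectrum ℂ T) := by
    by_contra! hf
    have hint : ∀ w ∈ segment ℝ 0 z, w ∈ spectrum ℂ T → w ∈ interior (spectrum ℂ T) :=
      fun w hw hws => by_contra fun hwi => hf w hw ⟨subset_closure hws, hwi⟩
    obtain ⟨w, -, hwi, hwn⟩ := (convex_segment (𝕜 := ℝ) (0 : ℂ) z).isPreconnected
      (interior (spectrum ℂ T)) (spectrum ℂ T)ᶜ isOpen_interior (spectrum.isClosed T).isOpen_compl
      (fun w hw => (em (w ∈ spectrum ℂ T)).imp (hint w hw) id)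
      ⟨0, left_mem_segment ℝ 0 z, hint 0 (left_mem_segment ℝ 0 z) h0⟩
      ⟨z, right_mem_segment ℝ 0 z, hzn⟩
    exact hwn (interior_subset hwi)
  have hw1 := hap w (frontier_spectrum_subset_sigmaAp T hwf)
  rw [segment_eq_image] at hw
  obtain ⟨t, ht, rfl⟩ := hw
  simp only [smul_zero, zero_add] at hw1 hwf
  rw [norm_smul, hz, mul_one, Real.norm_of_nonneg ht.1] at hw1
  rw [hw1, one_smul] at hwf
  exact hzn ((spectrum.isClosed T).frontier_subset hwf)

theorem nontrivial_of_minMod_pos {A : X →L[ℂ] X} (h : 0 < minMod A) : Nontrivial X := by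
  by_contra hn
  rw [not_nontrivial_iff_subsingleton] at hn
  have : {x : X | ‖x‖ = 1} = ∅ := by
    ext x
    simp [Subsingleton.elim x 0]
  simp [minMod, this] at h

/-- The growth exponents `log max (‖Tⁿ‖, m(Tⁿ)⁻¹)` are nonnegative, subadditive, and bound the
powers of `T` from above and below. -/
theorem growth_exponent_properties [Nontrivial X] {T : X →L[ℂ] X}
    (hm : ∀ n : ℕ, 0 < minMod (T ^ n)) {α : ℕ → ℝ}
    (hα : ∀ n, α n = Real.log (max ‖T ^ n‖ (minMod (T ^ n))⁻¹)) :
    (∀ n, 0 ≤ α n) ∧ α 0 = 0 ∧ (∀ m n, α (m + n) ≤ α m + α n) ∧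
      (∀ n, ‖T ^ n‖ ≤ Real.exp (α n)) ∧ ∀ n x, ‖x‖ ≤ Real.exp (α n) * ‖(T ^ n) x‖ := by
  have hpos : ∀ n, 0 < max ‖T ^ n‖ (minMod (T ^ n))⁻¹ := fun n =>
    lt_max_of_lt_right (inv_pos.2 (hm n))
  have hexp : ∀ n, Real.exp (α n) = max ‖T ^ n‖ (minMod (T ^ n))⁻¹ := fun n => by
    rw [hα, Real.exp_log (hpos n)]
  have hup : ∀ n, ‖T ^ n‖ ≤ Real.exp (α n) := fun n => hexp n ▸ le_max_left _ _
  have hlow : ∀ n x, ‖x‖ ≤ Real.exp (α n) * ‖(T ^ n) x‖ := fun n x => by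
    calc ‖x‖ ≤ (minMod (T ^ n))⁻¹ * ‖(T ^ n) x‖ := by
          rw [le_inv_mul_iff₀ (hm n)]
          exact minMod_mul_norm_le _ _
      _ ≤ _ := by
          gcongr
          exact hexp n ▸ le_max_right _ _
  have hle : ∀ n a, ‖T ^ n‖ ≤ Real.exp a → (∀ x, ‖x‖ ≤ Real.exp a * ‖(T ^ n) x‖) → α n ≤ a := by
    intro n a h1 h2
    rw [← Real.exp_le_exp, hexp]
    refine max_le h1 (inv_le_of_inv_le₀ (Real.exp_pos _) (le_minMod fun x => ?_))
    rw [inv_mul_le_iff₀ (Real.exp_pos _)]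
    exact h2 x
  have h0 : ∀ n, 0 ≤ α n := fun n => by
    obtain ⟨x, hx⟩ := nonempty_unit_sphere (X := X)
    rw [Set.mem_ofPred_eq] at hx
    have h1 := hlow n x
    have h2 := (T ^ n).le_opNorm x
    rw [hx, mul_one] at h2
    rw [hx] at h1
    have h3 : (1 : ℝ) ≤ Real.exp (α n) * Real.exp (α n) :=
      h1.trans (by gcongr; exact h2.trans (hup n))
    rw [← Real.exp_add, Real.one_le_exp_iff] at h3
    linarith
  refine ⟨h0, le_antisymm (hle 0 0 (by simp) (by simp)) (h0 0), fun m n => hle _ _ ?_ ?_, hup,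
    hlow⟩
  · rw [pow_add, Real.exp_add]
    exact (norm_mul_le _ _).trans (by gcongr <;> exact hup _)
  · intro x
    rw [pow_add, add_comm, Real.exp_add, mul_apply_eq_comp, mul_assoc]
    exact (hlow n x).trans (by gcongr; exact hlow m _)

theorem norm_zpow_le_of_growth {u : (X →L[ℂ] X)ˣ} {α : ℕ → ℝ}
    (hup : ∀ n, ‖(u : X →L[ℂ] X) ^ n‖ ≤ Real.exp (α n))
    (hlow : ∀ n x, ‖x‖ ≤ Real.exp (α n) * ‖((u : X →L[ℂ] X) ^ n) x‖) (n : ℤ) :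
    ‖((u ^ n : (X →L[ℂ] X)ˣ) : X →L[ℂ] X)‖ ≤ Real.exp (α n.natAbs) := by
  obtain ⟨k, rfl | rfl⟩ := n.eq_nat_or_neg
  · simpa using hup k
  · refine ContinuousLinearMap.opNorm_le_bound _ (Real.exp_pos _).le fun x => ?_
    have h := hlow k (((u ^ (-(k : ℤ)) : (X →L[ℂ] X)ˣ) : X →L[ℂ] X) x)
    rw [← mul_apply_eq_comp, ← Units.val_pow_eq_pow_val, ← Units.val_mul,
      zpow_neg, zpow_natCast, mul_inv_cancel, Units.val_one, one_apply_eq_self] at h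
    simpa using h

end Spectra

/-- Theorem 4.5: an operator satisfying the Beurling-type condition
`∑ log max(‖Tⁿ‖, m(Tⁿ)⁻¹)/n² < ∞` has an invertible extension `S` with
`∑_{n ∈ ℤ} log ‖Sⁿ‖/(1+n²) < ∞` and `σ(S) = σ_ap(T) = σ(T) ∩ 𝕋`. -/
theorem beurling_extension {X : Type u} [NormedAddCommGroup X]
    [NormedSpace ℂ X] [CompleteSpace X] (T : X →L[ℂ] X)
    (hm : ∀ n : ℕ, 1 ≤ n → 0 < minMod (T ^ n))
    (hB : Summable fun n : ℕ =>
      Real.log (max ‖T ^ (n + 1)‖ (minMod (T ^ (n + 1)))⁻¹) / ((n : ℝ) + 1) ^ 2) :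
    ∃ (Y : Type u) (_ : NormedAddCommGroup Y) (_ : NormedSpace ℂ Y) (_ : CompleteSpace Y)
      (π : X →L[ℂ] Y) (S : Y ≃L[ℂ] Y),
        (∀ x : X, ‖π x‖ = ‖x‖) ∧
        (∀ x : X, S (π x) = π (T x)) ∧
        (Summable fun n : ℤ =>
          Real.log ‖((S ^ n : Y ≃L[ℂ] Y) : Y →L[ℂ] Y)‖ / (1 + (n : ℝ) ^ 2)) ∧
        spectrum ℂ ((S : Y →L[ℂ] Y)) = sigmaAp T ∧
        sigmaAp T = spectrum ℂ T ∩ {z : ℂ | ‖z‖ = 1} := by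
  have hX : Nontrivial X := nontrivial_of_minMod_pos (hm 1 le_rfl)
  have hm' : ∀ n : ℕ, 0 < minMod (T ^ n) := fun n => by
    rcases Nat.eq_zero_or_pos n with rfl | hn
    · exact zero_lt_one.trans_le (le_minMod fun x => by simp)
    · exact hm n hn
  obtain ⟨α, hα⟩ : ∃ α : ℕ → ℝ, ∀ n, α n = Real.log (max ‖T ^ n‖ (minMod (T ^ n))⁻¹) :=
    ⟨_, fun _ => rfl⟩
  simp only [← hα] at hB
  obtain ⟨h0, hz, hadd, hup, hlow⟩ := growth_exponent_properties hm' hα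
  have hball : ∀ z ∈ spectrum ℂ T, ‖z‖ ≤ 1 := fun z hz => norm_le_one_of_mem_spectrum hB hup hz
  by_cases hT : IsUnit T
  · obtain ⟨u, rfl⟩ := hT
    have hu := norm_zpow_le_of_growth hup hlow
    have hcirc : ∀ z ∈ spectrum ℂ (u : X →L[ℂ] X), ‖z‖ = 1 :=
      fun z hz => norm_eq_one_of_mem_spectrum_unit hB hu hz
    have hap : ∀ z ∈ sigmaAp (u : X →L[ℂ] X), ‖z‖ = 1 := fun z hz =>
      hcirc z (sigmaAp_subset_spectrum_of_extension (A := (u : X →L[ℂ] X))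
        (ContinuousLinearMap.id ℂ X) (fun _ => rfl) (fun _ => rfl) hz)
    have hspec := sigmaAp_eq_spectrum_inter_circle hball hap
    refine ⟨X, inferInstance, inferInstance, inferInstance, ContinuousLinearMap.id ℂ X,
      ContinuousLinearEquiv.unitsEquiv ℂ X u, fun _ => rfl, fun _ => rfl, ?_, ?_, hspec⟩
    · simp only [coe_zpow_unitsEquiv]
      exact summable_log_norm_zpow hB hu
    · exact (hspec.trans (Set.inter_eq_left.2 hcirc)).symm
  · obtain ⟨γ, hγ0, hmono, hγadd, hγs, hγ⟩ :=
      exists_subadditive_dominating_dyadic_sums h0 hadd hB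
    obtain ⟨Y, i1, i2, i3, π, u, hπ, hint, hu⟩ := exists_invertible_extension T hγ0 hmono hγadd
      (exists_orbit T h0 hz hadd hup hlow hγ0 hγ)
    have hY : Nontrivial Y :=
      (show Function.Injective π from (AddMonoidHomClass.isometry_of_norm π hπ).injective).nontrivial
    have hcirc : ∀ z ∈ spectrum ℂ (u : Y →L[ℂ] Y), ‖z‖ = 1 :=
      fun z hz => norm_eq_one_of_mem_spectrum_unit hγs hu hz
    have hsub := sigmaAp_subset_spectrum_of_extension π hπ hint
    have hap : ∀ z ∈ sigmaAp T, ‖z‖ = 1 := fun z hz => hcirc z (hsub hz)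
    have hspec := sigmaAp_eq_spectrum_inter_circle hball hap
    refine ⟨Y, i1, i2, i3, π, ContinuousLinearEquiv.unitsEquiv ℂ Y u, hπ, hint, ?_, ?_, hspec⟩
    · simp only [coe_zpow_unitsEquiv]
      exact summable_log_norm_zpow hγs hu
    · exact subset_antisymm
        (fun z hz => circle_subset_sigmaAp hT hap hspec (hcirc z hz)) hsub
end

section
/- Let (v_n)_{n≥1} be a sequence of real numbers with v_n ≥ 1 for all n ≥ 1 and v_{m+n} ≤ v_m v_n for all m, n ≥ 1. If Σ_{n=1}^∞ (log v_n) / n² < ∞, then Σ_{n=1}^∞ (log v_{2^n}) / 2^n < ∞. -/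
open Finset in
/-- The sums of a nonnegative summable sequence over dyadic blocks are summable. -/
theorem summable_sum_Ico_two_pow {f : ℕ → ℝ} (hf : ∀ n, 0 ≤ f n) (hs : Summable f) :
    Summable fun k : ℕ => ∑ j ∈ Ico (2 ^ k) (2 ^ (k + 1)), f j := by
  refine summable_of_sum_range_le (c := ∑' n, f n) (fun k => sum_nonneg fun j _ => hf j) fun K => ?_
  have key : ∑ k ∈ range K, ∑ j ∈ Ico (2 ^ k) (2 ^ (k + 1)), f j = ∑ j ∈ Ico 1 (2 ^ K), f j := by
    induction K with
    | zero => simp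
    | succ K ih =>
      rw [sum_range_succ, ih, sum_Ico_consecutive f Nat.one_le_two_pow
        (Nat.pow_le_pow_right two_pos K.le_succ)]
  rw [key]
  exact hs.sum_le_tsum _ fun j _ => hf j

open Finset in
/-- A nonnegative subadditive sequence at `4 * M` is controlled by its values on `[M, 4 * M)`. -/
theorem subadditive_four_mul_le {a : ℕ → ℝ} (ha : ∀ n, 1 ≤ n → 0 ≤ a n)
    (hsub : ∀ m n, 1 ≤ m → 1 ≤ n → a (m + n) ≤ a m + a n) {M : ℕ} (hM : 1 ≤ M) :
    M * a (4 * M) ≤ ∑ j ∈ Ico M (4 * M), a j := by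
  have h1 : M * a (4 * M) ≤ ∑ j ∈ Ico M (2 * M), (a j + a (4 * M - j)) := by
    have h : ∑ _j ∈ Ico M (2 * M), a (4 * M) ≤ ∑ j ∈ Ico M (2 * M), (a j + a (4 * M - j)) := by
      refine sum_le_sum fun j hj => ?_
      rw [mem_Ico] at hj
      have := hsub j (4 * M - j) (by omega) (by omega)
      rwa [Nat.add_sub_cancel' (by omega)] at this
    rwa [sum_const, Nat.card_Ico, two_mul, Nat.add_sub_cancel, nsmul_eq_mul, ← two_mul] at h
  have h2 : ∑ j ∈ Ico M (2 * M), a (4 * M - j) ≤ ∑ j ∈ Ico (2 * M) (4 * M), a j := by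
    rw [← sum_image (s := Ico M (2 * M)) (g := fun j => 4 * M - j) (f := a)]
    · refine sum_le_sum_of_subset_of_nonneg ?_ fun j hj _ => ha j ?_
      · intro j hj
        simp only [mem_image, mem_Ico] at hj ⊢
        omega
      · rw [mem_Ico] at hj
        omega
    · intro i hi j hj hij
      simp only [coe_Ico, Set.mem_Ico] at hi hj hij
      omega
  rw [sum_add_distrib] at h1
  rw [← sum_Ico_consecutive a (by omega : M ≤ 2 * M) (by omega : 2 * M ≤ 4 * M)]
  linarith

open Finset in
/-- For a nonnegative subadditive sequence `a`, summability of `a n / n ^ 2` implies that of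
`a (2 ^ n) / 2 ^ n`. -/
theorem summable_dyadic_of_subadditive {a : ℕ → ℝ} (ha : ∀ n, 1 ≤ n → 0 ≤ a n)
    (hsub : ∀ m n, 1 ≤ m → 1 ≤ n → a (m + n) ≤ a m + a n)
    (hs : Summable fun n : ℕ => a n / (n : ℝ) ^ 2) :
    Summable fun n : ℕ => a (2 ^ n) / (2 : ℝ) ^ n := by
  have hf : ∀ n : ℕ, 0 ≤ a n / (n : ℝ) ^ 2 := by
    intro n
    rcases n.eq_zero_or_pos with rfl | hn
    · simp
    · exact div_nonneg (ha n hn) (by positivity)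
  have hS := summable_sum_Ico_two_pow hf hs
  rw [← summable_nat_add_iff 2]
  refine Summable.of_nonneg_of_le
    (fun n => div_nonneg (ha _ Nat.one_le_two_pow) (by positivity)) (fun k => ?_)
    ((hS.add ((summable_nat_add_iff 1).2 hS)).mul_left 4)
  rw [sum_Ico_consecutive _ (Nat.pow_le_pow_right two_pos k.le_succ)
    (Nat.pow_le_pow_right two_pos (k + 1).le_succ)]
  have hM : 1 ≤ 2 ^ k := Nat.one_le_two_pow
  have e : 2 ^ (k + 2) = 4 * 2 ^ k := by ring
  have e' : (2 : ℝ) ^ (k + 2) = 4 * ((2 ^ k : ℕ) : ℝ) := by push_cast; ring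
  rw [show k + 1 + 1 = k + 2 from rfl, e, e']
  generalize 2 ^ k = M at hM
  have hM' : (0 : ℝ) < M := by exact_mod_cast hM
  have hle : ∑ j ∈ Ico M (4 * M), a j ≤
      16 * (M : ℝ) ^ 2 * ∑ j ∈ Ico M (4 * M), a j / (j : ℝ) ^ 2 := by
    rw [mul_sum]
    refine sum_le_sum fun j hj => ?_
    rw [mem_Ico] at hj
    have hj0 : (0 : ℝ) < j := by exact_mod_cast hM.trans hj.1
    have hj4 : (j : ℝ) ≤ 4 * M := by exact_mod_cast hj.2.le
    calc a j = (j : ℝ) ^ 2 * (a j / (j : ℝ) ^ 2) := by field_simp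
      _ ≤ 16 * (M : ℝ) ^ 2 * (a j / (j : ℝ) ^ 2) :=
        mul_le_mul_of_nonneg_right (by nlinarith) (hf j)
  rw [div_le_iff₀ (by positivity)]
  refine le_of_mul_le_mul_left ?_ hM'
  calc M * a (4 * M) ≤ _ := (subadditive_four_mul_le ha hsub hM).trans hle
    _ = _ := by ring

/-- Claim a in the proof of Theorem 4.5: for a submultiplicative
sequence `v` with `v n ≥ 1`, the Beurling condition `∑ log v_n / n² < ∞` implies
`∑ log v_{2^n} / 2^n < ∞`. -/
theorem summable_log_dyadic (v : ℕ → ℝ)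
    (hv1 : ∀ n : ℕ, 1 ≤ n → 1 ≤ v n)
    (hsub : ∀ m n : ℕ, 1 ≤ m → 1 ≤ n → v (m + n) ≤ v m * v n)
    (hsum : Summable fun n : ℕ => Real.log (v (n + 1)) / ((n : ℝ) + 1) ^ 2) :
    Summable fun n : ℕ => Real.log (v (2 ^ (n + 1))) / (2 ^ (n + 1) : ℝ) := by
  have ha : ∀ n : ℕ, 1 ≤ n → 0 ≤ Real.log (v n) := fun n hn => Real.log_nonneg (hv1 n hn)
  have hpos : ∀ n : ℕ, 1 ≤ n → 0 < v n := fun n hn => one_pos.trans_le (hv1 n hn)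
  have hsub' : ∀ m n : ℕ, 1 ≤ m → 1 ≤ n →
      Real.log (v (m + n)) ≤ Real.log (v m) + Real.log (v n) := by
    intro m n hm hn
    rw [← Real.log_mul (hpos m hm).ne' (hpos n hn).ne']
    exact Real.log_le_log (hpos _ (by omega)) (hsub m n hm hn)
  have hs : Summable fun n : ℕ => Real.log (v n) / (n : ℝ) ^ 2 := by
    rw [← summable_nat_add_iff 1]
    simpa using hsum
  exact (summable_nat_add_iff 1).2 (summable_dyadic_of_subadditive ha hsub' hs)
end

section
/- Let X be a complex Banach space and T a bounded linear operator on X. Suppose there exist constants M > 0, C > 0 and 0 < s < 1/2 such that (1/(C e^{n^s})) ‖x‖ ≤ ‖T^n x‖ ≤ M ‖x‖ for all x ∈ X and all n ≥ 1, and suppose the spectrum of T is countable. Then (1/M) ‖x‖ ≤ ‖T^n x‖ ≤ M ‖x‖ for all x ∈ X and all n ≥ 1. -/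
universe u

section

open Filter Topology Complex Set MeasureTheory

theorem norm_le_of_subexponential_of_norm_le_imaginary_axis {E : Type*}
    [NormedAddCommGroup E] [NormedSpace ℂ E]
    {g : ℂ → E} {K : ℝ} (hd : DiffContOnCl ℂ g {z | 0 < z.re})
    (hg : ∀ δ > 0, ∃ B : ℝ, ∀ w : ℂ, 0 ≤ w.re → ‖g w‖ ≤ B * Real.exp (δ * ‖w‖))
    (him : ∀ x : ℝ, ‖g (x * I)‖ ≤ K) {w : ℂ} (hw : 0 ≤ w.re) : ‖g w‖ ≤ K := by
  have key : ∀ δ : ℝ, 0 < δ → ‖g w‖ ≤ K * Real.exp (δ * w.re) := by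
    intro δ hδ
    have hnorm : ∀ z : ℂ, ‖cexp (-(δ * z)) • g z‖ = Real.exp (-(δ * z.re)) * ‖g z‖ := by
      intro z
      rw [norm_smul, Complex.norm_exp]
      simp
    have h := PhragmenLindelof.right_half_plane_of_tendsto_zero_on_real
      (f := fun z => cexp (-(δ * z)) • g z) (C := K) (z := w) ?_ ?_ ?_ ?_ hw
    · rw [hnorm, Real.exp_neg, inv_mul_le_iff₀ (Real.exp_pos _)] at h
      linarith
    · exact DiffContOnCl.smul (Differentiable.diffContOnCl (by fun_prop)) hd
    · obtain ⟨B, hB⟩ := hg 1 one_pos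
      refine ⟨1, by norm_num, 1, Asymptotics.IsBigO.of_bound B ?_⟩
      refine eventually_inf_principal.2 (Eventually.of_forall fun z hz => ?_)
      have hz' : 0 < z.re := hz
      rw [hnorm, Real.norm_of_nonneg (Real.exp_pos _).le, Real.rpow_one]
      refine le_trans ?_ (hB z hz'.le)
      exact mul_le_of_le_one_left (norm_nonneg _) (Real.exp_le_one_iff.2 (by nlinarith))
    · obtain ⟨B, hB⟩ := hg (δ / 2) (half_pos hδ)
      have hlim : Tendsto (fun x : ℝ => B * Real.exp (-(δ / 2 * x))) atTop (𝓝 0) := by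
        have : Tendsto (fun x : ℝ => δ / 2 * x) atTop atTop :=
          tendsto_id.const_mul_atTop (half_pos hδ)
        simpa using (Real.tendsto_exp_neg_atTop_nhds_zero.comp this).const_mul B
      refine squeeze_zero_norm' ?_ hlim
      filter_upwards [eventually_ge_atTop (0 : ℝ)] with x hx
      have h1 := hB x (by simpa using hx)
      rw [hnorm, ofReal_re]
      rw [Complex.norm_real, Real.norm_of_nonneg hx] at h1
      calc _ ≤ Real.exp (-(δ * x)) * (B * Real.exp (δ / 2 * x)) := by gcongr
        _ = B * (Real.exp (-(δ * x)) * Real.exp (δ / 2 * x)) := by ring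
        _ = _ := by rw [← Real.exp_add]; congr 2; ring
    · intro x
      rw [hnorm]
      simpa using him x
  have hlim : Tendsto (fun δ : ℝ => K * Real.exp (δ * w.re)) (𝓝[>] 0) (𝓝 K) := by
    have : Continuous fun δ : ℝ => K * Real.exp (δ * w.re) := by fun_prop
    simpa using (this.tendsto 0).mono_left nhdsWithin_le_nhds
  exact ge_of_tendsto hlim (eventually_mem_nhdsWithin.mono fun δ hδ => key δ hδ)

theorem exists_mul_rpow_le_mul_add {p : ℝ} (hp : p < 1) (hp0 : 0 < p) (κ : ℝ) (hκ : 0 ≤ κ)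
    {δ : ℝ} (hδ : 0 < δ) :
    ∃ B : ℝ, ∀ x : ℝ, 0 ≤ x → κ * x ^ p ≤ δ * x + B := by
  have h : Tendsto (fun x : ℝ => κ * x ^ (-(1 - p))) atTop (𝓝 0) := by
    simpa using (tendsto_rpow_neg_atTop (sub_pos.2 hp)).const_mul κ
  obtain ⟨N, hN⟩ := eventually_atTop.1 ((h.eventually_le_const hδ).and (eventually_gt_atTop 0))
  have hN0 : 0 < N := (hN N le_rfl).2
  refine ⟨κ * N ^ p, fun x hx => ?_⟩
  rcases le_total N x with h | h
  · have hx0 : 0 < x := hN0.trans_le h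
    have h1 := mul_le_mul_of_nonneg_right (hN x h).1 hx
    have h2 : x ^ (-(1 - p)) * x = x ^ p := by
      rw [← Real.rpow_add_one hx0.ne']
      congr 1
      ring
    rw [mul_assoc, h2] at h1
    have : 0 ≤ κ * N ^ p := by positivity
    linarith
  · have : κ * x ^ p ≤ κ * N ^ p := by gcongr
    nlinarith [mul_nonneg hδ.le hx]

theorem norm_le_exp_rpow_of_norm_le_real_axis {E : Type*} [NormedAddCommGroup E] [NormedSpace ℂ E]
    {f : ℂ → E} (hf : Differentiable ℂ f)
    (htype : ∀ δ > 0, ∃ B : ℝ, ∀ z : ℂ, ‖f z‖ ≤ B * Real.exp (δ * ‖z‖)) {s K : ℝ} (hs0 : 0 < s)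
    (hs1 : s < 1) (hreal : ∀ t : ℝ, ‖f t‖ ≤ K * Real.exp (|t| ^ s)) :
    ∃ κ ≥ 0, ∀ z : ℂ, ‖f z‖ ≤ K * Real.exp (κ * ‖z‖ ^ s) := by
  have hcos : 0 < Real.cos (s * (Real.pi / 2)) :=
    Real.cos_pos_of_mem_Ioo ⟨by nlinarith [Real.pi_pos], by nlinarith [Real.pi_pos]⟩
  have hre : ∀ w : ℂ, (w ^ (s : ℂ)).re = ‖w‖ ^ s * Real.cos (s * w.arg) := by
    intro w
    rw [Complex.cpow_ofReal_re, mul_comm w.arg]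
  set κ : ℝ := (Real.cos (s * (Real.pi / 2)))⁻¹ with hκ
  have hκ0 : 0 < κ := inv_pos.2 hcos
  have hK : 0 ≤ K := by
    have := (norm_nonneg _).trans (hreal 0)
    exact nonneg_of_mul_nonneg_left this (Real.exp_pos _)
  have half : ∀ c : ℂ, (c = 1 ∨ c = -1) → ∀ w : ℂ, 0 ≤ w.re →
      ‖f (c * I * w)‖ ≤ K * Real.exp (κ * ‖w‖ ^ s) := by
    intro c hc w hw
    have hnc : ‖c‖ = 1 := by rcases hc with rfl | rfl <;> simp
    have hnorm : ∀ z : ℂ, ‖cexp (-(κ * z ^ (s : ℂ))) • f (c * I * z)‖ =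
        Real.exp (-(κ * (z ^ (s : ℂ)).re)) * ‖f (c * I * z)‖ := by
      intro z
      rw [norm_smul, Complex.norm_exp]
      simp
    have hpos : ∀ z : ℂ, 0 ≤ z.re → 0 ≤ (z ^ (s : ℂ)).re := by
      intro z hz
      have := abs_le.1 (Complex.abs_arg_le_pi_div_two_iff.2 hz)
      rw [hre]
      refine mul_nonneg (by positivity) (Real.cos_nonneg_of_mem_Icc ⟨?_, ?_⟩) <;>
        nlinarith [Real.pi_pos]
    have h := norm_le_of_subexponential_of_norm_le_imaginary_axis
      (g := fun z => cexp (-(κ * z ^ (s : ℂ))) • f (c * I * z)) (K := K) (w := w) ?_ ?_ ?_ hw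
    · rw [hnorm, Real.exp_neg, inv_mul_le_iff₀ (Real.exp_pos _)] at h
      refine h.trans ?_
      rw [mul_comm]
      gcongr
      exact (Complex.re_le_norm _).trans (by
        rw [Complex.norm_cpow_real])
    · refine DiffContOnCl.smul ⟨?_, ?_⟩ (Differentiable.diffContOnCl (by fun_prop))
      · intro z hz
        have : z ∈ slitPlane := Or.inl hz
        have h2 : DifferentiableAt ℂ (fun z : ℂ => z ^ (s : ℂ)) z :=
          differentiableAt_id.cpow_const this
        exact (by fun_prop : DifferentiableAt ℂ _ z).differentiableWithinAt
      · rw [closure_setOfPred_lt_re]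
        intro z hz
        have h2 : ContinuousAt (fun z : ℂ => z ^ (s : ℂ)) z := by
          refine Complex.continuousAt_cpow_const_of_re_pos (Or.inl hz) (by simpa using hs0)
        exact (by fun_prop : ContinuousAt _ z).continuousWithinAt
    · intro δ hδ
      obtain ⟨B, hB⟩ := htype δ hδ
      refine ⟨B, fun z hz => ?_⟩
      rw [hnorm]
      have h1 := hB (c * I * z)
      rw [norm_mul, norm_mul, hnc, norm_I, one_mul, one_mul] at h1
      refine le_trans (mul_le_of_le_one_left (norm_nonneg _) (Real.exp_le_one_iff.2 ?_)) h1
      have := mul_nonneg hκ0.le (hpos z hz)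
      linarith
    · intro x
      rw [hnorm]
      have hx : κ * ((x * I : ℂ) ^ (s : ℂ)).re = |x| ^ s := by
        rcases eq_or_ne x 0 with rfl | hx
        · simp [hs0.ne']
        rw [hre, norm_mul, norm_I, mul_one, Complex.norm_real, Real.norm_eq_abs]
        have : Real.cos (s * (x * I : ℂ).arg) = Real.cos (s * (Real.pi / 2)) := by
          rcases hx.lt_or_gt with hx | hx
          · have : (x * I : ℂ).arg = -(Real.pi / 2) := by
              rw [Complex.arg_eq_neg_pi_div_two_iff]; simp [hx]
            rw [this, mul_neg, Real.cos_neg]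
          · have : (x * I : ℂ).arg = Real.pi / 2 := by
              rw [Complex.arg_eq_pi_div_two_iff]; simp [hx]
            rw [this]
        rw [this, hκ, mul_left_comm, inv_mul_cancel₀ hcos.ne', mul_one]
      obtain ⟨y, hy, hyx⟩ : ∃ y : ℝ, c * I * (x * I) = y ∧ |y| = |x| := by
        rcases hc with rfl | rfl
        · exact ⟨-x, by push_cast; linear_combination (x : ℂ) * I_mul_I, abs_neg x⟩
        · exact ⟨x, by linear_combination (-x : ℂ) * I_mul_I, rfl⟩
      rw [hx, hy, Real.exp_neg, inv_mul_le_iff₀ (Real.exp_pos _), ← hyx, mul_comm]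
      exact hreal y
  refine ⟨κ, hκ0.le, fun z => ?_⟩
  rcases le_total 0 z.im with hz | hz
  · have := half 1 (Or.inl rfl) (-I * z) (by simpa using hz)
    rw [norm_mul, norm_neg, norm_I, one_mul, one_mul] at this
    convert this using 3
    linear_combination z * I_mul_I
  · have := half (-1) (Or.inr rfl) (I * z) (by simpa using hz)
    rw [norm_mul, norm_I, one_mul] at this
    convert this using 3
    linear_combination z * I_mul_I

theorem apply_eq_apply_of_bounded_on_positive_axis {E : Type*} [NormedAddCommGroup E]
    [NormedSpace ℂ E] {f : ℂ → E} (hf : Differentiable ℂ f)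
    (htype : ∀ δ > 0, ∃ B : ℝ, ∀ z : ℂ, ‖f z‖ ≤ B * Real.exp (δ * ‖z‖)) {s K : ℝ} (hs0 : 0 < s)
    (hs1 : s < 1 / 2) (hpos : ∀ t : ℝ, 0 ≤ t → ‖f t‖ ≤ K)
    (hneg : ∀ t : ℝ, 0 ≤ t → ‖f (-t)‖ ≤ K * Real.exp (t ^ s)) (z w : ℂ) : f z = f w := by
  have hK : 0 ≤ K := (norm_nonneg _).trans (hpos 0 le_rfl)
  obtain ⟨κ, hκ, hgrowth⟩ := norm_le_exp_rpow_of_norm_le_real_axis hf htype (K := K) hs0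
    (by linarith) (by
      intro t
      rcases le_total 0 t with ht | ht
      · exact (hpos t ht).trans (le_mul_of_one_le_right hK (Real.one_le_exp (by positivity)))
      · have := hneg (-t) (by linarith)
        rw [abs_of_nonpos ht]
        simpa using this)
  have hbound : ∀ v : ℂ, 0 ≤ v.re → ‖f (-v ^ 2)‖ ≤ K := by
    intro v hv
    refine norm_le_of_subexponential_of_norm_le_imaginary_axis (g := fun v => f (-v ^ 2))
      (Differentiable.diffContOnCl (by fun_prop)) ?_ ?_ hv
    · intro δ hδ
      obtain ⟨B, hB⟩ := exists_mul_rpow_le_mul_add (p := 2 * s) (by linarith) (by linarith) κ hκ hδ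
      refine ⟨K * Real.exp B, fun u _ => (hgrowth _).trans ?_⟩
      rw [mul_assoc, ← Real.exp_add]
      gcongr
      have := hB ‖u‖ (norm_nonneg _)
      rw [Real.rpow_mul (norm_nonneg _), Real.rpow_two] at this
      rw [norm_neg, norm_pow]
      linarith
    · intro x
      have := hpos (x ^ 2) (sq_nonneg x)
      have e : -((x : ℂ) * I) ^ 2 = ((x ^ 2 : ℝ) : ℂ) := by
        push_cast; linear_combination (-(x : ℂ) ^ 2) * I_sq
      rwa [← e] at this
  refine hf.apply_eq_apply_of_bounded ?_ z w
  refine (Metric.isBounded_closedBall (x := (0 : E)) (r := K)).subset ?_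
  rintro _ ⟨u, rfl⟩
  rw [mem_closedBall_zero_iff]
  obtain ⟨v, hv⟩ := IsAlgClosed.exists_pow_nat_eq (-u) two_pos
  have hu : u = -v ^ 2 := by rw [hv, neg_neg]
  rcases le_total 0 v.re with h | h
  · rw [hu]
    exact hbound v h
  · rw [hu, ← neg_sq]
    exact hbound (-v) (by simpa using h)

variable {E : Type*} [NormedAddCommGroup E] [NormedSpace ℂ E]

theorem differentiable_intervalIntegral_cexp_mul_smul [CompleteSpace E] {H : ℝ → ℂ}
    {G : ℝ → E} (hH : Continuous H) (hG : Continuous G) (a b : ℝ) :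
    Differentiable ℂ fun ζ : ℂ => ∫ θ in a..b, cexp (ζ * H θ) • G θ := by
  intro ζ₀
  have hcont : Continuous fun p : ℂ × ℝ => (H p.2 * cexp (p.1 * H p.2)) • G p.2 := by fun_prop
  obtain ⟨B, hB⟩ := ((isCompact_closedBall ζ₀ 1).prod (isCompact_uIcc (a := a) (b := b)))
    |>.exists_bound_of_continuousOn hcont.continuousOn
  refine (intervalIntegral.hasDerivAt_integral_of_dominated_loc_of_deriv_le
    (F := fun ζ θ => cexp (ζ * H θ) • G θ)
    (F' := fun ζ θ => (H θ * cexp (ζ * H θ)) • G θ) (bound := fun _ => B)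
    (Metric.closedBall_mem_nhds ζ₀ one_pos) ?_ ?_ ?_ ?_ ?_ ?_).2.differentiableAt
  · exact Eventually.of_forall fun ζ => Continuous.aestronglyMeasurable (by fun_prop)
  · exact Continuous.intervalIntegrable (by fun_prop) _ _
  · exact Continuous.aestronglyMeasurable (by fun_prop)
  · exact Eventually.of_forall fun θ hθ ζ hζ => hB (ζ, θ) ⟨hζ, uIoc_subset_uIcc hθ⟩
  · simp
  · refine Eventually.of_forall fun θ _ ζ _ => HasDerivAt.smul_const ?_ _
    have := ((hasDerivAt_id ζ).mul_const (H θ)).cexp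
    simpa [mul_comm] using this

theorem differentiable_circleIntegral_cexp_mul_smul [CompleteSpace E] {h : ℂ → ℂ}
    {g : ℂ → E} {c : ℂ} {R : ℝ} (hR : 0 ≤ R) (hh : ContinuousOn h (Metric.sphere c R))
    (hg : ContinuousOn g (Metric.sphere c R)) :
    Differentiable ℂ fun ζ : ℂ => ∮ z in C(c, R), cexp (ζ * h z) • g z := by
  have hH : Continuous fun θ => h (circleMap c R θ) :=
    hh.comp_continuous (continuous_circleMap c R) fun θ => circleMap_mem_sphere c hR θ
  have hG : Continuous fun θ => g (circleMap c R θ) :=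
    hg.comp_continuous (continuous_circleMap c R) fun θ => circleMap_mem_sphere c hR θ
  have hG' : Continuous fun θ => deriv (circleMap c R) θ • g (circleMap c R θ) := by
    simp only [deriv_circleMap]
    exact ((continuous_circleMap 0 R).mul continuous_const).smul hG
  convert differentiable_intervalIntegral_cexp_mul_smul hH hG' 0 (2 * Real.pi) using 2
  simp only [circleIntegral, smul_comm (cexp _)]

theorem ContinuousLinearMap.circleIntegral_comp_comm {F : Type*} [NormedAddCommGroup F]
    [NormedSpace ℂ F] [CompleteSpace E] [CompleteSpace F] (L : E →L[ℂ] F) {g : ℂ → E} {c : ℂ}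
    {R : ℝ} (hg : CircleIntegrable g c R) :
    (∮ z in C(c, R), L (g z)) = L (∮ z in C(c, R), g z) := by
  simp only [circleIntegral]
  rw [← L.intervalIntegral_comp_comm hg.out]
  simp

variable {A : Type*} [NormedRing A] [NormedAlgebra ℂ A]

theorem mul_resolvent_eq {a : A} {z : ℂ} (hz : z ∈ resolventSet ℂ a) :
    a * resolvent a z = z • resolvent a z - 1 := by
  have h := Ring.mul_inverse_cancel _ (spectrum.mem_resolventSet_iff.1 hz)
  rw [sub_mul, Algebra.algebraMap_eq_smul_one, smul_mul_assoc, one_mul] at h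
  rw [resolvent, Algebra.algebraMap_eq_smul_one]
  rw [eq_sub_iff_add_eq, ← eq_sub_iff_add_eq', h]

theorem resolvent_mul_eq {a : A} {z : ℂ} (hz : z ∈ resolventSet ℂ a) :
    resolvent a z * a = z • resolvent a z - 1 := by
  have h := Ring.inverse_mul_cancel _ (spectrum.mem_resolventSet_iff.1 hz)
  rw [mul_sub, Algebra.algebraMap_eq_smul_one, mul_smul_comm, mul_one] at h
  rw [resolvent, Algebra.algebraMap_eq_smul_one]
  rw [eq_sub_iff_add_eq, ← eq_sub_iff_add_eq', h]

variable [CompleteSpace A]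

theorem differentiableAt_resolvent {a : A} {z : ℂ} (hz : z ∈ resolventSet ℂ a) :
    DifferentiableAt ℂ (resolvent a) z :=
  (spectrum.hasDerivAt_resolvent_const_left hz).differentiableAt

/-- If the residue at `1` of the resolvent vanishes, then `1` is not in the spectrum. -/
theorem one_mem_resolventSet_of_circleIntegral_resolvent_eq_zero {a : A} {r : ℝ} (hr : 0 < r)
    (hres : ∀ z ∈ Metric.sphere (1 : ℂ) r, z ∈ resolventSet ℂ a)
    (h0 : (∮ z in C(1, r), resolvent a z) = 0) : (1 : ℂ) ∈ resolventSet ℂ a := by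
  have hc : ContinuousOn (resolvent a) (Metric.sphere (1 : ℂ) r) := fun z hz =>
    (differentiableAt_resolvent (hres z hz)).continuousAt.continuousWithinAt
  have hne : ∀ z ∈ Metric.sphere (1 : ℂ) r, z - 1 ≠ 0 := fun z hz h => by
    rw [sub_eq_zero.1 h] at hz
    simp [hr.ne] at hz
  have hinv : ContinuousOn (fun z : ℂ => (z - 1)⁻¹) (Metric.sphere 1 r) :=
    ContinuousOn.inv₀ (by fun_prop) hne
  have hint : CircleIntegrable (fun z => (z - 1)⁻¹ • resolvent a z) 1 r :=
    (hinv.smul hc).circleIntegrable hr.le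
  have key : ∀ L : A →L[ℂ] A, (∀ z ∈ Metric.sphere (1 : ℂ) r,
      L (resolvent a z) = 1 - (z - 1) • resolvent a z) →
      L (∮ z in C(1, r), (z - 1)⁻¹ • resolvent a z) = (2 * Real.pi * I : ℂ) • 1 := by
    intro L hL
    rw [← L.circleIntegral_comp_comm hint]
    have : (∮ z in C(1, r), L ((z - 1)⁻¹ • resolvent a z)) =
        ∮ z in C(1, r), ((z - 1)⁻¹ • (1 : A) - resolvent a z) := by
      refine circleIntegral.integral_congr hr.le fun z hz => ?_
      simp only [map_smul]
      rw [hL z hz, smul_sub, smul_smul, inv_mul_cancel₀ (hne z hz), one_smul]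
    rw [this, circleIntegral.integral_sub, h0, sub_zero, circleIntegral.integral_smul_const,
      circleIntegral.integral_sub_center_inv _ hr.ne']
    · exact (hinv.smul continuousOn_const).circleIntegrable hr.le
    · exact hc.circleIntegrable hr.le
  have h2 : (2 * Real.pi * I : ℂ) ≠ 0 := by simp [Real.pi_ne_zero]
  rw [spectrum.mem_resolventSet_iff, map_one]
  have hl := key (ContinuousLinearMap.mul ℂ A (1 - a)) fun z hz => by
    simp only [ContinuousLinearMap.mul_apply', sub_mul, one_mul, mul_resolvent_eq (hres z hz)]
    rw [sub_smul, one_smul]; abel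
  have hr' := key ((ContinuousLinearMap.mul ℂ A).flip (1 - a)) fun z hz => by
    simp only [ContinuousLinearMap.flip_apply, ContinuousLinearMap.mul_apply', mul_sub, mul_one,
      resolvent_mul_eq (hres z hz)]
    rw [sub_smul, one_smul]; abel
  simp only [ContinuousLinearMap.flip_apply, ContinuousLinearMap.mul_apply'] at hl hr'
  refine isUnit_iff_exists.2 ⟨(2 * Real.pi * I : ℂ)⁻¹ •
    ∮ z in C(1, r), (z - 1)⁻¹ • resolvent a z, ?_, ?_⟩
  · rw [mul_smul_comm, hl, smul_smul, inv_mul_cancel₀ h2, one_smul]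
  · rw [smul_mul_assoc, hr', smul_smul, inv_mul_cancel₀ h2, one_smul]

/-- For `1` an isolated point of the spectrum of an element with bounded positive powers and
negative powers of growth `exp (n ^ s)`, `s < 1 / 2`, there is a nonzero eigenelement. -/
theorem exists_mul_eq_self_of_isolated {a b : A} (hba : b * a = 1) {M C s r : ℝ}
    (hs0 : 0 < s) (hs1 : s < 1 / 2) (ha : ∀ n : ℕ, ‖a ^ n‖ ≤ M)
    (hb : ∀ n : ℕ, ‖b ^ n‖ ≤ C * Real.exp ((n : ℝ) ^ s)) (hr : 0 < r)
    (hres : ∀ z : ℂ, z ≠ 1 → ‖z - 1‖ ≤ r → z ∈ resolventSet ℂ a) (h1 : (1 : ℂ) ∈ spectrum ℂ a) :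
    ∃ e : A, e ≠ 0 ∧ a * e = e := by
  wlog hr2 : r ≤ 1 / 2 generalizing r
  · exact this (r := 1 / 2) (by norm_num) (fun z hz hz' => hres z hz (by linarith)) le_rfl
  have hsphere : ∀ {ρ : ℝ}, 0 < ρ → ρ ≤ r → ∀ z ∈ Metric.sphere (1 : ℂ) ρ,
      z ∈ resolventSet ℂ a := by
    intro ρ hρ hρr z hz
    rw [mem_sphere_iff_norm] at hz
    exact hres z (by rintro rfl; simp [hρ.ne] at hz) (by linarith)
  have hslit : ∀ z : ℂ, ‖z - 1‖ ≤ r → z ∈ slitPlane := fun z hz => by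
    left
    have := (Complex.abs_re_le_norm (z - 1)).trans hz
    rw [sub_re, one_re, abs_le] at this
    linarith
  have hclog : ∀ {ρ : ℝ}, ρ ≤ r → ContinuousOn Complex.log (Metric.sphere (1 : ℂ) ρ) :=
    fun hρ z hz => by
      rw [mem_sphere_iff_norm] at hz
      exact (continuousAt_clog (hslit z (by linarith))).continuousWithinAt
  have hcres : ∀ {ρ : ℝ}, 0 < ρ → ρ ≤ r →
      ContinuousOn (resolvent a) (Metric.sphere (1 : ℂ) ρ) := fun hρ hρr z hz =>
    (differentiableAt_resolvent (hsphere hρ hρr z hz)).continuousAt.continuousWithinAt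
  set f : ℂ → A := fun ζ => ∮ z in C(1, r), cexp (ζ * Complex.log z) • resolvent a z with hf
  have hdiff : Differentiable ℂ f :=
    differentiable_circleIntegral_cexp_mul_smul hr.le (hclog le_rfl) (hcres hr le_rfl)
  have hcint : ∀ {ρ : ℝ}, 0 < ρ → ρ ≤ r → ∀ ζ : ℂ,
      ContinuousOn (fun z => cexp (ζ * Complex.log z)) (Metric.sphere (1 : ℂ) ρ) :=
    fun _ hρ ζ => (continuousOn_const.mul (hclog hρ)).cexp
  have hshift : ∀ ζ : ℂ, f (ζ + 1) = a * f ζ := by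
    intro ζ
    have hL := (ContinuousLinearMap.mul ℂ A a).circleIntegral_comp_comm
      (g := fun z => cexp (ζ * Complex.log z) • resolvent a z)
      (((hcint hr le_rfl ζ).smul (hcres hr le_rfl)).circleIntegrable hr.le)
    simp only [ContinuousLinearMap.mul_apply'] at hL
    have hzero : (∮ z in C(1, r), cexp (ζ * Complex.log z) • (1 : A)) = 0 := by
      have hd : ∀ z ∈ Metric.closedBall (1 : ℂ) r,
          DifferentiableAt ℂ (fun z => cexp (ζ * Complex.log z) • (1 : A)) z := fun z hz => by
        have := differentiableAt_id.clog (hslit z (by rwa [mem_closedBall_iff_norm] at hz))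
        exact DifferentiableAt.smul_const (this.const_mul ζ).cexp _
      exact circleIntegral_eq_zero_of_differentiable_on_off_countable hr.le countable_empty
        (fun z hz => (hd z hz).continuousAt.continuousWithinAt)
        fun z hz => hd z (Metric.ball_subset_closedBall hz.1)
    simp only [hf]
    rw [← hL, ← add_zero (∮ z in C(1, r), a * _), ← hzero, ← circleIntegral.integral_add]
    · refine circleIntegral.integral_congr hr.le fun z hz => ?_
      have hz0 : z ≠ 0 := slitPlane_ne_zero
        (hslit z (by rw [mem_sphere_iff_norm] at hz; exact hz.le))
      simp only [mul_smul_comm]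
      rw [← smul_add, mul_resolvent_eq (hsphere hr le_rfl z hz), sub_add_cancel, add_mul, one_mul,
        Complex.exp_add, Complex.exp_log hz0, mul_smul]
    · exact ContinuousOn.circleIntegrable hr.le
        (continuousOn_const.mul ((hcint hr le_rfl ζ).smul (hcres hr le_rfl)))
    · exact ((hcint hr le_rfl ζ).smul continuousOn_const).circleIntegrable hr.le
  have hshift_nat : ∀ (n : ℕ) (ζ : ℂ), f (ζ + n) = a ^ n * f ζ := by
    intro n ζ
    induction n with
    | zero => simp
    | succ n ih => rw [Nat.cast_succ, ← add_assoc, hshift, ih, pow_succ', mul_assoc]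
  have hbn : ∀ n : ℕ, b ^ n * a ^ n = 1 := fun n => by
    induction n with
    | zero => simp
    | succ n ih => rw [pow_succ, pow_succ', mul_assoc, ← mul_assoc b, hba, one_mul, ih]
  have htype : ∀ δ > 0, ∃ B : ℝ, ∀ z : ℂ, ‖f z‖ ≤ B * Real.exp (δ * ‖z‖) := by
    intro δ hδ
    set ρ := min r (δ / 2) with hρdef
    have hρ : 0 < ρ := lt_min hr (half_pos hδ)
    have hρr : ρ ≤ r := min_le_left _ _
    have hρδ : ρ ≤ δ / 2 := min_le_right _ _
    obtain ⟨B, hB⟩ := (isCompact_sphere (1 : ℂ) ρ).exists_bound_of_continuousOn (hcres hρ hρr)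
    refine ⟨2 * Real.pi * ρ * B, fun ζ => ?_⟩
    have hrad : f ζ = ∮ z in C(1, ρ), cexp (ζ * Complex.log z) • resolvent a z := by
      have hd : ∀ z : ℂ, ρ ≤ ‖z - 1‖ → ‖z - 1‖ ≤ r →
          DifferentiableAt ℂ (fun z => cexp (ζ * Complex.log z) • resolvent a z) z := by
        intro z hz hz'
        have := differentiableAt_id.clog (hslit z hz')
        refine DifferentiableAt.smul (this.const_mul ζ).cexp
          (differentiableAt_resolvent (hres z ?_ hz'))
        rintro rfl
        simp [hρ.not_ge] at hz
      refine circleIntegral_eq_of_differentiable_on_annulus_off_countable hρ hρr countable_empty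
        (fun z hz => (hd z ?_ ?_).continuousAt.continuousWithinAt) fun z hz => hd z ?_ ?_
      · simpa [dist_eq_norm] using hz.2
      · simpa [dist_eq_norm] using hz.1
      · have := hz.1.2
        rw [mem_closedBall_iff_norm, not_le] at this
        exact this.le
      · exact (mem_ball_iff_norm.1 hz.1.1).le
    rw [hrad, mul_assoc _ B]
    refine circleIntegral.norm_integral_le_of_norm_le_const hρ.le fun z hz => ?_
    rw [norm_smul, mul_comm B, Complex.norm_exp]
    gcongr
    · refine (Complex.re_le_norm _).trans ?_
      rw [norm_mul, mul_comm]
      gcongr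
      rw [mem_sphere_iff_norm] at hz
      have := Complex.norm_log_one_add_half_le_self (z := z - 1) (by linarith)
      rw [add_sub_cancel, hz] at this
      linarith
    · exact hB z hz
  obtain ⟨Q, hQ⟩ := isCompact_Icc (a := (0 : ℝ)) (b := 1) |>.exists_bound_of_continuousOn
    (f := fun t : ℝ => f t) (hdiff.continuous.comp continuous_ofReal).continuousOn
  have hQ0 : 0 ≤ Q := (norm_nonneg _).trans (hQ 0 (by simp))
  have hM0 : 0 ≤ M := (norm_nonneg _).trans (ha 0)
  have hC0 : 0 ≤ C := nonneg_of_mul_nonneg_left ((norm_nonneg _).trans (hb 0)) (Real.exp_pos _)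
  have hconst := apply_eq_apply_of_bounded_on_positive_axis hdiff htype
    (K := M * Q + C * Real.exp 1 * Q) hs0 hs1 ?_ ?_
  · refine ⟨f 0, fun h0 => ?_, ?_⟩
    · refine h1 (one_mem_resolventSet_of_circleIntegral_resolvent_eq_zero hr (hsphere hr le_rfl) ?_)
      simpa [hf] using h0
    · rw [← hshift 0]
      exact hconst _ _
  · intro t ht
    have h := hshift_nat ⌊t⌋₊ ((t - ⌊t⌋₊ : ℝ) : ℂ)
    rw [ofReal_sub, ofReal_natCast, sub_add_cancel, ← ofReal_natCast, ← ofReal_sub] at h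
    rw [h]
    have h2 := hQ (t - ⌊t⌋₊) ⟨sub_nonneg.2 (Nat.floor_le ht),
      by linarith [Nat.lt_floor_add_one t]⟩
    calc _ ≤ ‖a ^ ⌊t⌋₊‖ * ‖f (t - ⌊t⌋₊ : ℝ)‖ := norm_mul_le _ _
      _ ≤ M * Q := by gcongr; exact ha _
      _ ≤ _ := by
        have : 0 ≤ C * Real.exp 1 * Q := by positivity
        linarith
  · intro t ht
    have h := hshift_nat ⌈t⌉₊ (-t)
    have h3 : f (-t) = b ^ ⌈t⌉₊ * f ((⌈t⌉₊ - t : ℝ) : ℂ) := by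
      have e : ((⌈t⌉₊ - t : ℝ) : ℂ) = -t + (⌈t⌉₊ : ℂ) := by push_cast; ring
      rw [e, h, ← mul_assoc, hbn, one_mul]
    have hceil := Nat.ceil_lt_add_one ht
    have h2 := hQ (⌈t⌉₊ - t) ⟨sub_nonneg.2 (Nat.le_ceil t), by linarith⟩
    have hpow : (⌈t⌉₊ : ℝ) ^ s ≤ t ^ s + 1 := by
      calc (⌈t⌉₊ : ℝ) ^ s ≤ (t + 1) ^ s := by gcongr
        _ ≤ t ^ s + 1 ^ s := Real.rpow_add_le_add_rpow ht zero_le_one hs0.le (by linarith)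
        _ = _ := by rw [Real.one_rpow]
    rw [h3]
    calc _ ≤ ‖b ^ ⌈t⌉₊‖ * ‖f (⌈t⌉₊ - t : ℝ)‖ := norm_mul_le _ _
      _ ≤ (C * Real.exp (t ^ s + 1)) * Q := by
        gcongr
        exact (hb _).trans (by gcongr)
      _ = C * Real.exp 1 * Q * Real.exp (t ^ s) := by rw [Real.exp_add]; ring
      _ ≤ _ := by
        gcongr
        have : 0 ≤ M * Q := by positivity
        linarith

theorem exists_isolated_of_countable {K : Set ℂ} (hK : IsClosed K) (hc : K.Countable)
    (hne : K.Nonempty) : ∃ l ∈ K, ∃ r > 0, ∀ z, z ≠ l → ‖z - l‖ ≤ r → z ∉ K := by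
  by_contra! h
  have hperf : Perfect K := by
    refine ⟨hK, preperfect_iff_nhds.2 fun l hl U hU => ?_⟩
    obtain ⟨r, hr, hrU⟩ := Metric.nhds_basis_closedBall.mem_iff.1 hU
    obtain ⟨z, hz, hzr, hzK⟩ := h l hl r hr
    exact ⟨z, ⟨hrU (mem_closedBall_iff_norm.2 hzr), hzK⟩, hz⟩
  obtain ⟨f, hf, -, hinj⟩ := hperf.exists_nat_bool_injection hne
  have h1 : (Set.range f).Countable := hc.mono hf
  rw [← Set.image_univ] at h1
  have h2 := Set.countable_of_injective_of_countable_image hinj.injOn h1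
  have := Set.countable_univ_iff.1 h2
  obtain ⟨g, hg⟩ := exists_surjective_nat (ℕ → Bool)
  obtain ⟨n, hn⟩ := hg fun k => !(g k k)
  have := congr_fun hn n
  simp at this

theorem le_one_of_forall_pow_le_exp_rpow {q C s : ℝ} (hs0 : 0 < s) (hs1 : s < 1)
    (h : ∀ n : ℕ, q ^ n ≤ C * Real.exp ((n : ℝ) ^ s)) : q ≤ 1 := by
  by_contra! hq
  have hC : 0 ≤ C := nonneg_of_mul_nonneg_left (le_trans (by simp) (h 0)) (Real.exp_pos _)
  have hlog : 0 < Real.log q := Real.log_pos hq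
  obtain ⟨B, hB⟩ := exists_mul_rpow_le_mul_add hs1 hs0 1 zero_le_one (half_pos hlog)
  have hlim : Tendsto (fun n : ℕ => Real.exp (Real.log q / 2 * n)) atTop atTop :=
    Real.tendsto_exp_atTop.comp
      (tendsto_natCast_atTop_atTop.const_mul_atTop (half_pos hlog))
  obtain ⟨n, hn⟩ := (hlim.eventually_gt_atTop (C * Real.exp B)).exists
  have h1 : q ^ n = Real.exp (Real.log q / 2 * n) * Real.exp (Real.log q / 2 * n) := by
    rw [← Real.exp_add, ← Real.exp_log (zero_lt_one.trans hq), ← Real.exp_nat_mul, Real.log_exp]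
    congr 1
    ring
  have h2 : Real.exp ((n : ℝ) ^ s) ≤ Real.exp (Real.log q / 2 * n) * Real.exp B := by
    rw [← Real.exp_add]
    exact Real.exp_le_exp.2 (by simpa using hB n n.cast_nonneg)
  have h3 := (h n).trans (mul_le_mul_of_nonneg_left h2 hC)
  rw [h1] at h3
  nlinarith [Real.exp_pos (Real.log q / 2 * n)]

theorem exists_mul_eq_smul_of_countable_spectrum [Nontrivial A] {a b : A} (hab : a * b = 1)
    (hba : b * a = 1) {M C s : ℝ} (hs0 : 0 < s) (hs1 : s < 1 / 2) (ha : ∀ n : ℕ, ‖a ^ n‖ ≤ M)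
    (hb : ∀ n : ℕ, ‖b ^ n‖ ≤ C * Real.exp ((n : ℝ) ^ s)) (hc : (spectrum ℂ a).Countable) :
    ∃ (e : A) (l : ℂ), e ≠ 0 ∧ ‖l‖ = 1 ∧ a * e = l • e := by
  obtain ⟨l, hl, r, hr, hiso⟩ :=
    exists_isolated_of_countable (spectrum.isClosed a) hc (spectrum.nonempty a)
  have hM0 : 0 ≤ M := (norm_nonneg _).trans (ha 0)
  have hl1 : ‖l‖ ≤ 1 := by
    refine le_one_of_forall_pow_le_exp_rpow (C := M * ‖(1 : A)‖) hs0 (by linarith) fun n => ?_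
    have := spectrum.norm_le_norm_mul_of_mem (spectrum.pow_mem_pow a n hl)
    rw [norm_pow] at this
    calc _ ≤ M * ‖(1 : A)‖ := this.trans (by gcongr; exact ha n)
      _ ≤ _ := le_mul_of_one_le_right (by positivity) (Real.one_le_exp (by positivity))
  let u : Aˣ := ⟨a, b, hab, hba⟩
  have hl0 : l ≠ 0 := by
    rintro rfl
    exact spectrum.zero_notMem ℂ u.isUnit hl
  have hlinv : l⁻¹ ∈ spectrum ℂ b := by
    have := (spectrum.inv_mem_iff (r := Units.mk0 l hl0) (a := u)).1 hl
    simpa [u] using this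
  have hl2 : ‖l⁻¹‖ ≤ 1 := by
    refine le_one_of_forall_pow_le_exp_rpow (C := C * ‖(1 : A)‖) hs0 (by linarith) fun n => ?_
    have := spectrum.norm_le_norm_mul_of_mem (spectrum.pow_mem_pow b n hlinv)
    rw [norm_pow] at this
    calc _ ≤ C * Real.exp ((n : ℝ) ^ s) * ‖(1 : A)‖ := this.trans (by gcongr; exact hb n)
      _ = _ := by ring
  have hnl : ‖l‖ = 1 := by
    refine le_antisymm hl1 ?_
    rw [norm_inv] at hl2
    exact (inv_le_one₀ (norm_pos_iff.2 hl0)).1 hl2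
  have hspec : ∀ z : ℂ, z ∈ spectrum ℂ (l⁻¹ • a) ↔ l * z ∈ spectrum ℂ a := by
    intro z
    have h := spectrum.unit_smul_eq_smul a (Units.mk0 l hl0)⁻¹
    have e : (Units.mk0 l hl0)⁻¹ • a = l⁻¹ • a := rfl
    rw [← e, h, Set.mem_inv_smul_set_iff]
    rfl
  obtain ⟨e, he0, he⟩ := exists_mul_eq_self_of_isolated (a := l⁻¹ • a) (b := l • b) (M := M)
    (C := C) (s := s) (r := r)
    (by rw [smul_mul_smul_comm, mul_inv_cancel₀ hl0, hba, one_smul]) hs0 hs1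
    (fun n => by
      rw [smul_pow, norm_smul, norm_pow, norm_inv, hnl, inv_one, one_pow, one_mul]
      exact ha n)
    (fun n => by rw [smul_pow, norm_smul, norm_pow, hnl, one_pow, one_mul]; exact hb n) hr
    (by
      intro z hz hzr
      by_contra hmem
      refine hiso (l * z) (fun h => hz (mul_left_cancel₀ hl0 (by rw [h, mul_one]))) ?_
        ((hspec z).1 hmem)
      rwa [← mul_sub_one, norm_mul, hnl, one_mul])
    ((hspec 1).2 (by rwa [mul_one]))
  refine ⟨e, l, he0, hnl, ?_⟩
  nth_rewrite 2 [← he]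
  rw [smul_mul_assoc, smul_smul, mul_inv_cancel₀ hl0, one_smul]

/-- There is a nonprincipal ultrafilter on `ℕ` which is idempotent for addition. -/
theorem exists_idempotent_ultrafilter_le_atTop :
    ∃ u : Ultrafilter ℕ, (u : Filter ℕ) ≤ atTop ∧
      ∀ p : ℕ → Prop, (∀ᶠ n in u, p n) → ∀ᶠ m in u, ∀ᶠ n in u, p (m + n) := by
  let _ := Ultrafilter.addSemigroup (M := ℕ+)
  obtain ⟨v, hv⟩ := exists_idempotent_of_compact_t2_of_continuous_add_left
    (Ultrafilter.continuous_add_left (M := ℕ+))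
  have hev : ∀ p : ℕ+ → Prop, (∀ᶠ n in v, p n) ↔ ∀ᶠ m in v, ∀ᶠ n in v, p (m + n) := by
    intro p
    have := Ultrafilter.eventually_add v v p
    rwa [hv] at this
  refine ⟨v.map (fun n : ℕ+ => (n : ℕ)), ?_, ?_⟩
  · rcases v.le_cofinite_or_eq_pure with h | ⟨k, rfl⟩
    · rw [← Nat.cofinite_eq_atTop]
      exact (Filter.map_mono h).trans PNat.coe_injective.tendsto_cofinite
    · have h := (hev (fun n => n = k)).1 (by simp)
      simp only [Ultrafilter.coe_pure, eventually_pure] at h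
      have := congrArg PNat.val h
      have := k.pos
      grind [PNat.add_coe]
  · intro p hp
    have := (hev (fun n => p n)).1 hp
    simpa using this

variable {X : Type*} [NormedAddCommGroup X] [NormedSpace ℂ X]

theorem isUnit_of_bounded_below_of_countable_spectrum [CompleteSpace X] [Nontrivial X]
    {T : X →L[ℂ] X} {α : ℝ} (hα : 0 < α) (hT : ∀ x, α * ‖x‖ ≤ ‖T x‖)
    (hc : (spectrum ℂ T).Countable) : IsUnit T := by
  obtain ⟨z, hzα, hz⟩ := (hc.dense_compl ℂ).inter_open_nonempty _
    (Metric.isOpen_ball (x := (0 : ℂ)) (ε := α / 2)) ⟨0, Metric.mem_ball_self (half_pos hα)⟩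
  rw [mem_ball_zero_iff] at hzα
  obtain ⟨v, hv⟩ : IsUnit (algebraMap ℂ (X →L[ℂ] X) z - T) := by
    simpa [spectrum.mem_iff] using hz
  have hvx : ∀ x, (v : X →L[ℂ] X) x = z • x - T x := fun x => by
    rw [hv, Algebra.algebraMap_eq_smul_one]; simp
  have hnorm : ‖(↑v⁻¹ : X →L[ℂ] X)‖ ≤ (α - ‖z‖)⁻¹ := by
    refine ContinuousLinearMap.opNorm_le_bound _ (inv_nonneg.2 (by linarith)) fun y => ?_
    have h1 : (v : X →L[ℂ] X) ((↑v⁻¹ : X →L[ℂ] X) y) = y := by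
      rw [← mul_apply_eq_comp, Units.mul_inv, one_apply_eq_self]
    set x := (↑v⁻¹ : X →L[ℂ] X) y
    rw [hvx] at h1
    rw [le_inv_mul_iff₀ (by linarith), ← h1]
    have := norm_sub_norm_le (T x) (z • x)
    rw [norm_sub_rev, norm_smul] at this
    linarith [hT x]
  have hpos : 0 < ‖(↑v⁻¹ : X →L[ℂ] X)‖ := Units.norm_pos _
  have := (Units.ofNearby v (-T) (by
    have e : -T - v = -(z • (1 : X →L[ℂ] X)) := by
      rw [hv, Algebra.algebraMap_eq_smul_one]; abel
    rw [e, norm_neg, norm_smul, norm_one, mul_one]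
    have := inv_anti₀ hpos hnorm
    rw [inv_inv] at this
    linarith)).isUnit
  simpa using this

/-- The limit along an ultrafilter of the adjoint powers of a power bounded operator. -/
theorem exists_ultrafilter_limit_dual_pow (u : Ultrafilter ℕ) {T : X →L[ℂ] X} {M : ℝ}
    (hT : ∀ n : ℕ, ‖T ^ n‖ ≤ M) :
    ∃ U : StrongDual ℂ X →L[ℂ] StrongDual ℂ X,
      ∀ (f : StrongDual ℂ X) (x : X), Tendsto (fun n => f ((T ^ n) x)) u (𝓝 (U f x)) := by
  have hex : ∀ (f : StrongDual ℂ X) (x : X), ∃ L : ℂ, ‖L‖ ≤ M * ‖f‖ * ‖x‖ ∧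
      Tendsto (fun n => f ((T ^ n) x)) u (𝓝 L) := by
    intro f x
    have hb : ∀ n, f ((T ^ n) x) ∈ Metric.closedBall (0 : ℂ) (M * ‖f‖ * ‖x‖) := fun n => by
      rw [mem_closedBall_zero_iff]
      calc _ ≤ ‖f‖ * (‖T ^ n‖ * ‖x‖) := f.le_opNorm_of_le ((T ^ n).le_opNorm x)
        _ ≤ ‖f‖ * (M * ‖x‖) := by gcongr; exact hT n
        _ = _ := by ring
    obtain ⟨L, hL, hlim⟩ := (isCompact_closedBall (0 : ℂ) (M * ‖f‖ * ‖x‖)).ultrafilter_le_nhds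
      (u.map fun n => f ((T ^ n) x)) (by
        rw [le_principal_iff]
        exact Filter.mem_map.2 (Eventually.of_forall hb))
    exact ⟨L, mem_closedBall_zero_iff.1 hL, hlim⟩
  choose L hLb hL using hex
  refine ⟨LinearMap.mkContinuous₂ (LinearMap.mk₂ ℂ L ?_ ?_ ?_ ?_) M hLb, fun f x => hL f x⟩
  · exact fun f g x => tendsto_nhds_unique (hL _ _) (by simpa using (hL f x).add (hL g x))
  · exact fun c f x => tendsto_nhds_unique (hL _ _) (by simpa using (hL f x).const_mul c)
  · exact fun f x y => tendsto_nhds_unique (hL _ _) (by simpa using (hL f x).add (hL f y))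
  · exact fun c f x => tendsto_nhds_unique (hL _ _) (by simpa using (hL f x).const_mul c)

theorem comp_mem_ker_of_commute {u : Filter ℕ} [u.NeBot] {T B : X →L[ℂ] X}
    {U : StrongDual ℂ X →L[ℂ] StrongDual ℂ X}
    (hU : ∀ (f : StrongDual ℂ X) (x : X), Tendsto (fun n => f ((T ^ n) x)) u (𝓝 (U f x)))
    (hB : Commute B T) {f : StrongDual ℂ X} (hf : f ∈ U.ker) : f.comp B ∈ U.ker := by
  rw [LinearMap.mem_ker] at hf ⊢
  ext x
  refine tendsto_nhds_unique (hU (f.comp B) x) ?_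
  have h := hU f (B x)
  have hf' : U f = 0 := hf
  rw [hf'] at h
  refine h.congr fun n => ?_
  have := congrArg (fun S : X →L[ℂ] X => f (S x)) (hB.pow_right n).eq
  exact this.symm

theorem limit_dual_pow_idem {u : Ultrafilter ℕ}
    (hu : ∀ p : ℕ → Prop, (∀ᶠ n in u, p n) → ∀ᶠ m in u, ∀ᶠ n in u, p (m + n))
    {T : X →L[ℂ] X} {U : StrongDual ℂ X →L[ℂ] StrongDual ℂ X}
    (hU : ∀ (f : StrongDual ℂ X) (x : X), Tendsto (fun n => f ((T ^ n) x)) u (𝓝 (U f x)))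
    (f : StrongDual ℂ X) : U (U f) = U f := by
  ext x
  refine tendsto_nhds_unique (hU (U f) x) ?_
  rw [Metric.nhds_basis_closedBall.tendsto_right_iff]
  intro ε hε
  filter_upwards [hu _ ((hU f x).eventually (Metric.closedBall_mem_nhds _ hε))] with m hm
  refine Metric.isClosed_closedBall.mem_of_tendsto (hU f ((T ^ m) x)) (hm.mono fun n hn => ?_)
  rwa [add_comm, pow_add] at hn

section Restrict

theorem exists_eigenvector_of_countable_spectrum {Y : Type*} [NormedAddCommGroup Y]
    [NormedSpace ℂ Y] [CompleteSpace Y] [Nontrivial Y] {a b : Y →L[ℂ] Y}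
    (hab : ∀ f, a (b f) = f) (hba : ∀ f, b (a f) = f) {M C s : ℝ} (hM : 0 ≤ M) (hC : 0 ≤ C)
    (hs0 : 0 < s) (hs1 : s < 1 / 2) (ha : ∀ (n : ℕ) f, ‖a^[n] f‖ ≤ M * ‖f‖)
    (hb : ∀ (n : ℕ) f, ‖b^[n] f‖ ≤ C * Real.exp ((n : ℝ) ^ s) * ‖f‖) {K : Set ℂ}
    (hK : K.Countable) (hres : ∀ z ∉ K, ∃ R : Y →L[ℂ] Y,
      (∀ f, R (z • f - a f) = f) ∧ ∀ f, z • R f - a (R f) = f) :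
    ∃ f : Y, f ≠ 0 ∧ ∃ l : ℂ, ‖l‖ = 1 ∧ a f = l • f := by
  have hspec : spectrum ℂ a ⊆ K := by
    intro z hz
    by_contra hzK
    obtain ⟨R, h1, h2⟩ := hres z hzK
    have hval : ∀ f : Y, (algebraMap ℂ (Y →L[ℂ] Y) z - a) f = z • f - a f := fun f => by
      rw [Algebra.algebraMap_eq_smul_one]
      rfl
    have hR1 : (algebraMap ℂ (Y →L[ℂ] Y) z - a) * R = 1 := by
      ext f
      rw [mul_apply_eq_comp, hval, h2, one_apply_eq_self]
    have hR2 : R * (algebraMap ℂ (Y →L[ℂ] Y) z - a) = 1 := by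
      ext f
      rw [mul_apply_eq_comp, hval, h1, one_apply_eq_self]
    exact hz (Units.mk _ _ hR1 hR2).isUnit
  obtain ⟨e, l, he0, hl, he⟩ := exists_mul_eq_smul_of_countable_spectrum (M := M) (C := C)
    (ContinuousLinearMap.ext hab) (ContinuousLinearMap.ext hba) hs0 hs1
    (fun n => ContinuousLinearMap.opNorm_le_bound _ hM fun f => by
      rw [pow_apply_eq_iterate]; exact ha n f)
    (fun n => ContinuousLinearMap.opNorm_le_bound _ (by positivity) fun f => by
      rw [pow_apply_eq_iterate]; exact hb n f) (hK.mono hspec)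
  obtain ⟨f, hf⟩ : ∃ f, e f ≠ 0 := by
    by_contra! h
    exact he0 (ContinuousLinearMap.ext h)
  exact ⟨e f, hf, l, hl, by rw [← mul_apply_eq_comp, he]; rfl⟩

variable {D : Type*} [NormedAddCommGroup D] [NormedSpace ℂ D] {V : Submodule ℂ D}

/-- The restriction of a bounded operator to an invariant subspace. -/
noncomputable def restrictInvariant (V : Submodule ℂ D) (B : D →L[ℂ] D) (hB : ∀ f ∈ V, B f ∈ V) :
    V →L[ℂ] V :=
  (B.comp V.subtypeL).codRestrict V fun f => hB f f.2

theorem coe_restrictInvariant_apply {B : D →L[ℂ] D} (hB : ∀ f ∈ V, B f ∈ V) (f : V) :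
    (restrictInvariant V B hB f : D) = B f := rfl

theorem coe_restrictInvariant_iterate {B : D →L[ℂ] D} (hB : ∀ f ∈ V, B f ∈ V) (n : ℕ) (f : V) :
    ((restrictInvariant V B hB)^[n] f : D) = B^[n] f := by
  induction n with
  | zero => rfl
  | succ n ih =>
    rw [Function.iterate_succ_apply', Function.iterate_succ_apply', coe_restrictInvariant_apply, ih]

theorem exists_mem_eigenvector [CompleteSpace D] (hVc : IsClosed (V : Set D)) (hne : V ≠ ⊥)
    {P Q : D →L[ℂ] D} (hPV : ∀ f ∈ V, P f ∈ V) (hQV : ∀ f ∈ V, Q f ∈ V)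
    (hPQ : ∀ f, P (Q f) = f) (hQP : ∀ f, Q (P f) = f) {M C s : ℝ} (hM : 0 ≤ M) (hC : 0 ≤ C)
    (hs0 : 0 < s) (hs1 : s < 1 / 2) (hP : ∀ (n : ℕ) f, ‖P^[n] f‖ ≤ M * ‖f‖)
    (hQ : ∀ (n : ℕ) f, ‖Q^[n] f‖ ≤ C * Real.exp ((n : ℝ) ^ s) * ‖f‖) {K : Set ℂ}
    (hK : K.Countable) (hres : ∀ z ∉ K, ∃ R : D →L[ℂ] D, (∀ f ∈ V, R f ∈ V) ∧
      (∀ f, R (z • f - P f) = f) ∧ ∀ f, z • R f - P (R f) = f) :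
    ∃ f ∈ V, f ≠ 0 ∧ ∃ l : ℂ, ‖l‖ = 1 ∧ P f = l • f := by
  have : Nontrivial V := Submodule.nontrivial_iff_ne_bot.2 hne
  have : CompleteSpace V := hVc.completeSpace_coe
  obtain ⟨f, hf0, l, hl, hf⟩ := exists_eigenvector_of_countable_spectrum (Y := V)
    (a := restrictInvariant V P hPV) (b := restrictInvariant V Q hQV)
    (fun f => Subtype.ext (hPQ f)) (fun f => Subtype.ext (hQP f)) hM hC hs0 hs1
    (fun n f => by
      rw [← Submodule.norm_coe, coe_restrictInvariant_iterate]; exact hP n f)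
    (fun n f => by
      rw [← Submodule.norm_coe, coe_restrictInvariant_iterate]; exact hQ n f) hK
    (fun z hz => by
      obtain ⟨R, hRV, h1, h2⟩ := hres z hz
      exact ⟨restrictInvariant V R hRV, fun f => Subtype.ext (h1 f), fun f => Subtype.ext (h2 f)⟩)
  exact ⟨f, f.2, fun h => hf0 (Subtype.ext h), l, hl, congrArg Subtype.val hf⟩

end Restrict

/-- The Banach space adjoint of a bounded operator. -/
noncomputable def dualAdjoint (B : X →L[ℂ] X) : StrongDual ℂ X →L[ℂ] StrongDual ℂ X :=
  (ContinuousLinearMap.compL ℂ X X ℂ).flip B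

theorem dualAdjoint_apply (B : X →L[ℂ] X) (f : StrongDual ℂ X) : dualAdjoint B f = f.comp B := rfl

theorem dualAdjoint_iterate (B : X →L[ℂ] X) (n : ℕ) (f : StrongDual ℂ X) :
    (dualAdjoint B)^[n] f = f.comp (B ^ n) := by
  induction n with
  | zero => rfl
  | succ n ih =>
    rw [Function.iterate_succ_apply', ih, dualAdjoint_apply, pow_succ]
    rfl

theorem norm_dualAdjoint_iterate_le {B : X →L[ℂ] X} {n : ℕ} {c : ℝ} (h : ‖B ^ n‖ ≤ c)
    (f : StrongDual ℂ X) : ‖(dualAdjoint B)^[n] f‖ ≤ c * ‖f‖ := by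
  rw [dualAdjoint_iterate, mul_comm]
  exact (f.opNorm_comp_le _).trans (by gcongr)

theorem ker_limit_dual_pow_eq_bot {u : Ultrafilter ℕ} {T S : X →L[ℂ] X} (hTS : T * S = 1)
    (hST : S * T = 1) {M C s : ℝ} (hC : 0 ≤ C) (hs0 : 0 < s) (hs1 : s < 1 / 2)
    (hT : ∀ n : ℕ, ‖T ^ n‖ ≤ M)
    (hS : ∀ n : ℕ, ‖S ^ n‖ ≤ C * Real.exp ((n : ℝ) ^ s)) (hc : (spectrum ℂ T).Countable)
    {U : StrongDual ℂ X →L[ℂ] StrongDual ℂ X}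
    (hU : ∀ (f : StrongDual ℂ X) (x : X), Tendsto (fun n => f ((T ^ n) x)) u (𝓝 (U f x))) :
    U.ker = ⊥ := by
  by_contra hne
  have hV : ∀ B : X →L[ℂ] X, Commute B T → ∀ f ∈ U.ker, dualAdjoint B f ∈ U.ker :=
    fun B hB f hf => comp_mem_ker_of_commute hU hB hf
  have hinv : ∀ {B D : X →L[ℂ] X}, D * B = 1 → ∀ f, dualAdjoint B (dualAdjoint D f) = f :=
    fun h f => ContinuousLinearMap.ext fun x => congrArg (fun S : X →L[ℂ] X => f (S x)) h
  have hres : ∀ z ∉ spectrum ℂ T, ∃ R : StrongDual ℂ X →L[ℂ] StrongDual ℂ X,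
      (∀ f ∈ U.ker, R f ∈ U.ker) ∧ (∀ f, R (z • f - dualAdjoint T f) = f) ∧
      ∀ f, z • R f - dualAdjoint T (R f) = f := by
    intro z hz
    obtain ⟨v, hv⟩ : IsUnit (algebraMap ℂ (X →L[ℂ] X) z - T) := by
      simpa [spectrum.mem_iff] using hz
    have hvT : Commute (v : X →L[ℂ] X) T := by
      rw [hv]
      exact Commute.sub_left (Algebra.commutes z T) (Commute.refl T)
    have e : ∀ f, z • f - dualAdjoint T f = dualAdjoint (v : X →L[ℂ] X) f := by
      intro f
      ext x
      rw [hv, Algebra.algebraMap_eq_smul_one]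
      simp [dualAdjoint_apply]
    refine ⟨dualAdjoint (↑v⁻¹ : X →L[ℂ] X), hV _ hvT.units_inv_left, fun f => ?_, fun f => ?_⟩
    · rw [e, hinv v.mul_inv]
    · rw [e, hinv v.inv_mul]
  obtain ⟨f, hf, hf0, l, hl, hfl⟩ := exists_mem_eigenvector U.isClosed_ker hne
    (hV T (Commute.refl T)) (hV S (hST.trans hTS.symm)) (hinv hST) (hinv hTS)
    ((norm_nonneg _).trans (hT 0)) hC hs0 hs1
    (fun n => norm_dualAdjoint_iterate_le (hT n)) (fun n => norm_dualAdjoint_iterate_le (hS n))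
    hc hres
  have heig : ∀ x, f (T x) = l * f x := fun x => congrArg (fun g : StrongDual ℂ X => g x) hfl
  have hpow : ∀ (n : ℕ) x, ‖f ((T ^ n) x)‖ = ‖f x‖ := by
    intro n x
    induction n with
    | zero => simp
    | succ n ih => rw [pow_succ', mul_apply_eq_comp, heig, norm_mul, hl, one_mul, ih]
  refine hf0 (ContinuousLinearMap.ext fun x => ?_)
  have h := hU f x
  have h0 : U f = 0 := hf
  rw [h0] at h
  have h1 := h.norm
  simp only [hpow] at h1
  exact norm_eq_zero.1 ((tendsto_nhds_unique tendsto_const_nhds h1).trans norm_zero)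

theorem norm_le_mul_norm_pow_of_countable_spectrum {T S : X →L[ℂ] X} (hTS : T * S = 1)
    (hST : S * T = 1) {M C s : ℝ} (hC : 0 ≤ C) (hs0 : 0 < s) (hs1 : s < 1 / 2)
    (hT : ∀ n : ℕ, 1 ≤ n → ∀ x, ‖(T ^ n) x‖ ≤ M * ‖x‖)
    (hS : ∀ n : ℕ, ‖S ^ n‖ ≤ C * Real.exp ((n : ℝ) ^ s)) (hc : (spectrum ℂ T).Countable)
    (x : X) (k : ℕ) : ‖x‖ ≤ M * ‖(T ^ k) x‖ := by
  obtain ⟨u, hu, hidem⟩ := exists_idempotent_ultrafilter_le_atTop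
  have hT' : ∀ n : ℕ, ‖T ^ n‖ ≤ max M 1 := by
    intro n
    refine ContinuousLinearMap.opNorm_le_bound _ (by positivity) fun y => ?_
    rcases n.eq_zero_or_pos with rfl | hn
    · simpa using le_mul_of_one_le_left (norm_nonneg y) (le_max_right M 1)
    · exact (hT n hn y).trans (by gcongr; exact le_max_left _ _)
  obtain ⟨U, hU⟩ := exists_ultrafilter_limit_dual_pow u hT'
  have hker := ker_limit_dual_pow_eq_bot hTS hST hC hs0 hs1 hT' hS hc hU
  rcases eq_or_ne x 0 with rfl | hx
  · simp
  obtain ⟨f, hf1, hfx⟩ := exists_dual_vector ℂ x (norm_ne_zero_iff.2 hx)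
  have hUf : U f = f := by
    have h : U f - f ∈ U.ker := by
      change U (U f - f) = 0
      rw [map_sub, limit_dual_pow_idem hidem hU, sub_self]
    rw [hker, Submodule.mem_bot] at h
    exact sub_eq_zero.1 h
  have hlim := (hU f x).norm
  rw [hUf, hfx] at hlim
  simp only [RCLike.norm_ofReal, abs_norm] at hlim
  refine le_of_tendsto hlim ?_
  filter_upwards [hu (eventually_ge_atTop (k + 1))] with n hn
  obtain ⟨m, rfl⟩ := Nat.exists_eq_add_of_le hn
  rw [show k + 1 + m = (m + 1) + k by ring, pow_add, mul_apply_eq_comp]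
  calc _ ≤ ‖f‖ * ‖(T ^ (m + 1)) ((T ^ k) x)‖ := f.le_opNorm _
    _ ≤ _ := by rw [hf1, one_mul]; exact hT _ (by lia) _

end

/-- **Statement 17** (Theorem 4.9): a power-bounded operator (with bound `M`) whose
iterates are bounded below by `1/(C e^{n^s})` with `0 < s < 1/2`, and whose spectrum is
countable, satisfies the growth condition `(P(0))`:
`‖x‖/M ≤ ‖Tⁿ x‖ ≤ M ‖x‖`. -/
theorem countable_spectrum_P0 {X : Type u} [NormedAddCommGroup X]
    [NormedSpace ℂ X] [CompleteSpace X] (T : X →L[ℂ] X)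
    (M C s : ℝ) (hM : 0 < M) (hC : 0 < C) (hs0 : 0 < s) (hs1 : s < 1 / 2)
    (hgrow : ∀ x : X, ∀ n : ℕ, 1 ≤ n →
      ‖x‖ / (C * Real.exp ((n : ℝ) ^ s)) ≤ ‖(T ^ n) x‖ ∧ ‖(T ^ n) x‖ ≤ M * ‖x‖)
    (hcount : (spectrum ℂ T).Countable) :
    ∀ x : X, ∀ n : ℕ, 1 ≤ n → ‖x‖ / M ≤ ‖(T ^ n) x‖ ∧ ‖(T ^ n) x‖ ≤ M * ‖x‖ := by
  intro x n hn
  refine ⟨?_, (hgrow x n hn).2⟩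
  rcases eq_or_ne x 0 with rfl | hx
  · simp
  have : Nontrivial X := ⟨x, 0, hx⟩
  obtain ⟨v, rfl⟩ : IsUnit T := by
    refine isUnit_of_bounded_below_of_countable_spectrum
      (α := (C * Real.exp ((1 : ℕ) ^ s : ℝ))⁻¹) (by positivity) (fun y => ?_) hcount
    have := (hgrow y 1 le_rfl).1
    rwa [pow_one, div_eq_inv_mul] at this
  rw [div_le_iff₀' hM]
  refine norm_le_mul_norm_pow_of_countable_spectrum v.mul_inv v.inv_mul (C := max C 1)
    (by positivity) hs0 hs1 (fun m hm y => (hgrow y m hm).2) (fun m => ?_) hcount x n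
  refine ContinuousLinearMap.opNorm_le_bound _ (by positivity) fun y => ?_
  rcases m.eq_zero_or_pos with rfl | hm
  · simp [Real.zero_rpow hs0.ne']
    refine le_mul_of_one_le_left (norm_nonneg y) (le_max_right C 1)
  · have h := (hgrow (((↑v⁻¹ : X →L[ℂ] X) ^ m) y) m hm).1
    rw [← mul_apply_eq_comp, ← Units.val_pow_eq_pow_val,
      ← Units.val_pow_eq_pow_val, inv_pow, Units.mul_inv, one_apply_eq_self,
      div_le_iff₀' (by positivity)] at h
    rw [← Units.val_pow_eq_pow_val, inv_pow]
    exact h.trans (by gcongr; exact le_max_left _ _)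
end
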